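/- Let (g,c,n) be a v-admissible triplet and r a positive integer. Suppose G1, G2 ∈ G(g,c,n) have m1 and m2 edges, respectively, with δ(G1) = A(g,c,n) and δ(G2) = B(g,c,n). Then A(rg, rc, n1) ≤ r·A(g,c,n) ≤ r·B(g,c,n) ≤ B(rg, rc, n2) for every integer n1 ≥ n + (r-1)·m1 and every integer n2 ≥ n + (r-1)·m2. -/

import Mathlib

open SimpleGraph Set

/-- Auxiliary distance on representations of points of the metric graph:
a point is represented by `(u, v, t)` with `u, v` adjacent and `t ∈ [0,1]`,
meaning the point on the edge `[u,v]` at distance `t` from `u`. -/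
noncomputable def mgDistAux {V : Type} [Fintype V] [DecidableEq V] (G : SimpleGraph V)
    (p q : V × V × ℝ) : ℝ :=
  min
    (min (if p.1 = q.1 ∧ p.2.1 = q.2.1 then |p.2.2 - q.2.2| else (Fintype.card V : ℝ) + 1)
         (if p.1 = q.2.1 ∧ p.2.1 = q.1 then |p.2.2 - (1 - q.2.2)| else (Fintype.card V : ℝ) + 1))
    (min (min (p.2.2 + (G.dist p.1 q.1 : ℝ) + q.2.2)
              (p.2.2 + (G.dist p.1 q.2.1 : ℝ) + (1 - q.2.2)))
         (min ((1 - p.2.2) + (G.dist p.2.1 q.1 : ℝ) + q.2.2)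
              ((1 - p.2.2) + (G.dist p.2.1 q.2.1 : ℝ) + (1 - q.2.2))))

/-- The points of the metric graph associated to a simple graph `G`:
the vertices together with the interior points of the edges. -/
def MGPoint {V : Type} (G : SimpleGraph V) : Type :=
  {p : V × V × ℝ // G.Adj p.1 p.2.1 ∧ p.2.2 ∈ Set.Icc (0 : ℝ) 1}

/-- The shortest-path distance on the metric graph associated to `G`
(every edge has length 1). -/
noncomputable def mgDist {V : Type} [Fintype V] [DecidableEq V] (G : SimpleGraph V)
    (p q : MGPoint G) : ℝ := mgDistAux G p.1 q.1

/-- Distance from a vertex `v` to a point of the metric graph. -/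
noncomputable def mgVDist {V : Type} [Fintype V] [DecidableEq V] (G : SimpleGraph V)
    (v : V) (x : MGPoint G) : ℝ :=
  min ((G.dist v x.1.1 : ℝ) + x.1.2.2) ((G.dist v x.1.2.1 : ℝ) + (1 - x.1.2.2))

/-- `γ` restricted to `[a,b]` is a geodesic in the metric graph of `G`
(an arc-length parametrization realizing distances). -/
def IsMGGeodesic {V : Type} [Fintype V] [DecidableEq V] (G : SimpleGraph V)
    (a b : ℝ) (γ : ℝ → MGPoint G) : Prop :=
  a ≤ b ∧ ∀ s ∈ Set.Icc a b, ∀ t ∈ Set.Icc a b, mgDist G (γ s) (γ t) = |s - t|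

/-- A geodesic triangle in the metric graph of `G`: three geodesic sides whose
endpoints match cyclically (distance `0` means equality of points). -/
structure MGTriangle {V : Type} [Fintype V] [DecidableEq V] (G : SimpleGraph V) where
  a1 : ℝ
  b1 : ℝ
  a2 : ℝ
  b2 : ℝ
  a3 : ℝ
  b3 : ℝ
  g1 : ℝ → MGPoint G
  g2 : ℝ → MGPoint G
  g3 : ℝ → MGPoint G
  h1 : IsMGGeodesic G a1 b1 g1
  h2 : IsMGGeodesic G a2 b2 g2
  h3 : IsMGGeodesic G a3 b3 g3
  glue1 : mgDist G (g1 b1) (g2 a2) = 0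
  glue2 : mgDist G (g2 b2) (g3 a3) = 0
  glue3 : mgDist G (g3 b3) (g1 a1) = 0

/-- The sharp thin constant `δ(T)` of a geodesic triangle: the infimum of the
`d ≥ 0` such that each side is contained in the `d`-neighborhood of the union of
the other two sides. -/
noncomputable def triangleDelta {V : Type} [Fintype V] [DecidableEq V] {G : SimpleGraph V}
    (T : MGTriangle G) : ℝ :=
  sInf {d : ℝ | 0 ≤ d ∧
    (∀ s ∈ Set.Icc T.a1 T.b1,
      (∃ t ∈ Set.Icc T.a2 T.b2, mgDist G (T.g1 s) (T.g2 t) ≤ d) ∨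
      (∃ t ∈ Set.Icc T.a3 T.b3, mgDist G (T.g1 s) (T.g3 t) ≤ d)) ∧
    (∀ s ∈ Set.Icc T.a2 T.b2,
      (∃ t ∈ Set.Icc T.a1 T.b1, mgDist G (T.g2 s) (T.g1 t) ≤ d) ∨
      (∃ t ∈ Set.Icc T.a3 T.b3, mgDist G (T.g2 s) (T.g3 t) ≤ d)) ∧
    (∀ s ∈ Set.Icc T.a3 T.b3,
      (∃ t ∈ Set.Icc T.a1 T.b1, mgDist G (T.g3 s) (T.g1 t) ≤ d) ∨
      (∃ t ∈ Set.Icc T.a2 T.b2, mgDist G (T.g3 s) (T.g2 t) ≤ d))}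

/-- The hyperbolicity constant `δ(G)`: the supremum of `δ(T)` over all geodesic
triangles `T` in the metric graph of `G`. -/
noncomputable def hypDelta {V : Type} [Fintype V] [DecidableEq V] (G : SimpleGraph V) : ℝ :=
  sSup {d : ℝ | ∃ T : MGTriangle G, d = triangleDelta T}

/-- The circumference of `G`: the length of a longest cycle. -/
noncomputable def circumference {V : Type} (G : SimpleGraph V) : ℕ :=
  sSup {n : ℕ | ∃ (a : V) (w : G.Walk a a), w.IsCycle ∧ w.length = n}

/-- `G` belongs to the class `𝒢(g,c,n)` of (connected) graphs with girth `g`,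
circumference `c` and `n` vertices (vertex set `Fin n`). -/
def memGclass (g c : ℕ) {n : ℕ} (G : SimpleGraph (Fin n)) : Prop :=
  G.Connected ∧ G.girth = g ∧ circumference G = c

/-- `A(g,c,n) = min {δ(G) : G ∈ 𝒢(g,c,n)}`. -/
noncomputable def Agcn (g c n : ℕ) : ℝ :=
  sInf {d : ℝ | ∃ G : SimpleGraph (Fin n), memGclass g c G ∧ d = hypDelta G}

/-- `B(g,c,n) = max {δ(G) : G ∈ 𝒢(g,c,n)}`. -/
noncomputable def Bgcn (g c n : ℕ) : ℝ :=
  sSup {d : ℝ | ∃ G : SimpleGraph (Fin n), memGclass g c G ∧ d = hypDelta G}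

/-- `G` belongs to the class `ℋ(g,c,m)` of (connected) graphs with girth `g`,
circumference `c` and `m` edges. -/
def memHclass (g c m : ℕ) {k : ℕ} (G : SimpleGraph (Fin k)) : Prop :=
  G.Connected ∧ G.girth = g ∧ circumference G = c ∧ G.edgeSet.ncard = m

/-- `α(g,c,m) = min {δ(G) : G ∈ ℋ(g,c,m)}`. -/
noncomputable def alphagcm (g c m : ℕ) : ℝ :=
  sInf {d : ℝ | ∃ (k : ℕ) (G : SimpleGraph (Fin k)), memHclass g c m G ∧ d = hypDelta G}

/-- `β(g,c,m) = max {δ(G) : G ∈ ℋ(g,c,m)}`. -/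
noncomputable def betagcm (g c m : ℕ) : ℝ :=
  sSup {d : ℝ | ∃ (k : ℕ) (G : SimpleGraph (Fin k)), memHclass g c m G ∧ d = hypDelta G}


set_option linter.unusedSectionVars false

/-- A pseudometric, as a plain real-valued function. -/
structure IsPM {X : Type} (D : X → X → ℝ) : Prop where
  refl : ∀ x, D x x = 0
  symm : ∀ x y, D x y = D y x
  tri : ∀ x y z, D x z ≤ D x y + D y z

/-- The point of the metric graph at distance `t` from `u` on the edge `[u,v]`. -/
def mpt {V : Type} {G : SimpleGraph V} (u v : V) (h : G.Adj u v) (t : ℝ)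
    (ht : t ∈ Set.Icc (0:ℝ) 1) : MGPoint G := ⟨(u, v, t), h, ht⟩

theorem exists_mpt {V : Type} {G : SimpleGraph V} (x : MGPoint G) :
    ∃ u v h t ht, x = mpt u v h t ht := by
  obtain ⟨⟨u, v, t⟩, h, ht⟩ := x
  exact ⟨u, v, h, t, ht, rfl⟩

theorem zero_mem_I : (0:ℝ) ∈ Set.Icc (0:ℝ) 1 := by simp

theorem one_mem_I : (1:ℝ) ∈ Set.Icc (0:ℝ) 1 := by simp

theorem sub_mem_I {t : ℝ} (ht : t ∈ Set.Icc (0:ℝ) 1) : 1 - t ∈ Set.Icc (0:ℝ) 1 := by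
  constructor <;> linarith [ht.1, ht.2]

theorem dist_lt_card {V : Type} [Fintype V] [DecidableEq V] {G : SimpleGraph V}
    (hG : G.Connected) (u v : V) : G.dist u v < Fintype.card V := by
  obtain ⟨p, hp, hl⟩ := hG.exists_path_of_dist u v
  rw [← hl]; exact hp.length_lt

theorem min6_choice (a b c d e f : ℝ) :
    min (min a b) (min (min c d) (min e f)) = a ∨ min (min a b) (min (min c d) (min e f)) = b ∨
    min (min a b) (min (min c d) (min e f)) = c ∨ min (min a b) (min (min c d) (min e f)) = d ∨
    min (min a b) (min (min c d) (min e f)) = e ∨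
    min (min a b) (min (min c d) (min e f)) = f := by
  rcases min_choice (min a b) (min (min c d) (min e f)) with h | h <;> rw [h]
  · rcases min_choice a b with h | h <;> simp [h]
  · rcases min_choice (min c d) (min e f) with h | h <;> rw [h]
    · rcases min_choice c d with h | h <;> simp [h]
    · rcases min_choice e f with h | h <;> simp [h]

section metric

variable {V : Type} [Fintype V] [DecidableEq V] {G : SimpleGraph V}

theorem mgDist_le_F {u v h t ht u' v' h' t' ht'} :
    mgDist G (mpt u v h t ht) (mpt u' v' h' t' ht') ≤ t + G.dist u u' + t' ∧
    mgDist G (mpt u v h t ht) (mpt u' v' h' t' ht') ≤ t + G.dist u v' + (1 - t') ∧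
    mgDist G (mpt u v h t ht) (mpt u' v' h' t' ht') ≤ (1 - t) + G.dist v u' + t' ∧
    mgDist G (mpt u v h t ht) (mpt u' v' h' t' ht') ≤ (1 - t) + G.dist v v' + (1 - t') := by
  simp only [mgDist, mgDistAux, mpt]
  refine ⟨?_, ?_, ?_, ?_⟩ <;> simp only [min_le_iff, le_refl, true_or, or_true]

theorem mgDist_le_E {u v h t ht h' t' ht'} :
    mgDist G (mpt u v h t ht) (mpt u v h' t' ht') ≤ |t - t'| := by
  simp [mgDist, mgDistAux, mpt]

theorem mgDist_le_E' {u v h t ht h' t' ht'} :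
    mgDist G (mpt u v h t ht) (mpt v u h' t' ht') ≤ |t - (1 - t')| := by
  simp [mgDist, mgDistAux, mpt]

theorem mgDist_cases (hG : G.Connected) {u v h t ht u' v' h' t' ht'} :
    (u = u' ∧ v = v' ∧ mgDist G (mpt u v h t ht) (mpt u' v' h' t' ht') = |t - t'|) ∨
    (u = v' ∧ v = u' ∧ mgDist G (mpt u v h t ht) (mpt u' v' h' t' ht') = |t - (1 - t')|) ∨
    mgDist G (mpt u v h t ht) (mpt u' v' h' t' ht') = t + G.dist u u' + t' ∨
    mgDist G (mpt u v h t ht) (mpt u' v' h' t' ht') = t + G.dist u v' + (1 - t') ∨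
    mgDist G (mpt u v h t ht) (mpt u' v' h' t' ht') = (1 - t) + G.dist v u' + t' ∨
    mgDist G (mpt u v h t ht) (mpt u' v' h' t' ht') = (1 - t) + G.dist v v' + (1 - t') := by
  have hF := @mgDist_le_F V _ _ G u v h t ht u' v' h' t' ht'
  have key : mgDist G (mpt u v h t ht) (mpt u' v' h' t' ht') < Fintype.card V + 1 := by
    have h1 : (G.dist u u' : ℝ) < Fintype.card V := by exact_mod_cast dist_lt_card hG u u'
    have h2 : (G.dist v v' : ℝ) < Fintype.card V := by exact_mod_cast dist_lt_card hG v v'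
    linarith [hF.1, hF.2.2.2]
  have e : mgDist G (mpt u v h t ht) (mpt u' v' h' t' ht') =
      min (min (if u = u' ∧ v = v' then |t - t'| else (Fintype.card V : ℝ) + 1)
        (if u = v' ∧ v = u' then |t - (1 - t')| else (Fintype.card V : ℝ) + 1))
      (min (min (t + G.dist u u' + t') (t + G.dist u v' + (1 - t')))
        (min ((1 - t) + G.dist v u' + t') ((1 - t) + G.dist v v' + (1 - t')))) := rfl
  rcases min6_choice (if u = u' ∧ v = v' then |t - t'| else (Fintype.card V : ℝ) + 1)
    (if u = v' ∧ v = u' then |t - (1 - t')| else (Fintype.card V : ℝ) + 1)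
    (t + G.dist u u' + t') (t + G.dist u v' + (1 - t')) ((1 - t) + G.dist v u' + t')
    ((1 - t) + G.dist v v' + (1 - t')) with m | m | m | m | m | m
  · rw [m] at e
    split_ifs at e with hc
    · exact Or.inl ⟨hc.1, hc.2, e⟩
    · linarith
  · rw [m] at e
    split_ifs at e with hc
    · exact Or.inr (Or.inl ⟨hc.1, hc.2, e⟩)
    · linarith
  all_goals rw [m] at e; simp only [e, true_or, or_true]

theorem mgDist_nonneg (hG : G.Connected) (x y : MGPoint G) : 0 ≤ mgDist G x y := by
  obtain ⟨u, v, h, t, ht, rfl⟩ := exists_mpt x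
  obtain ⟨u', v', h', t', ht', rfl⟩ := exists_mpt y
  have := ht.1; have := ht.2; have := ht'.1; have := ht'.2
  rcases mgDist_cases hG (h := h) (ht := ht) (h' := h') (ht' := ht') with
    ⟨-, -, e⟩ | ⟨-, -, e⟩ | e | e | e | e <;> rw [e]
  · positivity
  · positivity
  all_goals
    refine add_nonneg (add_nonneg ?_ (Nat.cast_nonneg _)) ?_ <;> linarith

theorem mgDist_lt_card (hG : G.Connected) (x y : MGPoint G) :
    mgDist G x y ≤ Fintype.card V + 1 := by
  obtain ⟨u, v, h, t, ht, rfl⟩ := exists_mpt x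
  obtain ⟨u', v', h', t', ht', rfl⟩ := exists_mpt y
  have hF := @mgDist_le_F V _ _ G u v h t ht u' v' h' t' ht'
  have h1 : (G.dist u u' : ℝ) < Fintype.card V := by exact_mod_cast dist_lt_card hG u u'
  have h2 : (G.dist v v' : ℝ) < Fintype.card V := by exact_mod_cast dist_lt_card hG v v'
  linarith [hF.1, hF.2.2.2]

theorem mgDist_le_symm (hG : G.Connected) (x y : MGPoint G) :
    mgDist G x y ≤ mgDist G y x := by
  obtain ⟨u, v, h, t, ht, rfl⟩ := exists_mpt x
  obtain ⟨u', v', h', t', ht', rfl⟩ := exists_mpt y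
  have hF := @mgDist_le_F V _ _ G u v h t ht u' v' h' t' ht'
  rw [G.dist_comm (u := u) (v := u'), G.dist_comm (u := u) (v := v'),
    G.dist_comm (u := v) (v := u'), G.dist_comm (u := v) (v := v')] at hF
  obtain ⟨h1, h2, h3, h4⟩ := hF
  rcases mgDist_cases hG (h := h') (ht := ht') (h' := h) (ht' := ht) with
    ⟨rfl, rfl, e⟩ | ⟨rfl, rfl, e⟩ | e | e | e | e <;> rw [e]
  · rw [abs_sub_comm]; exact mgDist_le_E
  · have : |t' - (1 - t)| = |t - (1 - t')| := by congr 1; ring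
    rw [this]; exact mgDist_le_E'
  all_goals linarith

theorem dist_tri4 (hG : G.Connected) (a b c d : V) :
    (G.dist a d : ℝ) ≤ G.dist a b + G.dist b c + G.dist c d := by
  have h1 := hG.dist_triangle (u := a) (v := b) (w := d)
  have h2 := hG.dist_triangle (u := b) (v := c) (w := d)
  exact_mod_cast (by omega : G.dist a d ≤ G.dist a b + G.dist b c + G.dist c d)

/-- Abstract version of the triangle inequality: moving along one edge. -/
theorem mgDist_tri_E (hG : G.Connected) (x : MGPoint G) {u v h t ht h' t' ht'} :
    mgDist G x (mpt u v h' t' ht') ≤ mgDist G x (mpt u v h t ht) + |t - t'| := by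
  obtain ⟨a, b, k, s, hs, rfl⟩ := exists_mpt x
  obtain ⟨h1, h2, h3, h4⟩ := @mgDist_le_F V _ _ G a b k s hs u v h' t' ht'
  have i1 := le_abs_self (t - t')
  have i2 := neg_abs_le (t - t')
  rcases mgDist_cases hG (h := k) (ht := hs) (h' := h) (ht' := ht) with
    ⟨rfl, rfl, e⟩ | ⟨rfl, rfl, e⟩ | e | e | e | e <;> rw [e]
  · exact mgDist_le_E.trans (abs_sub_le _ _ _)
  · refine mgDist_le_E'.trans ((abs_sub_le _ (1 - t) _).trans ?_)
    have : |(1 - t) - (1 - t')| = |t - t'| := by rw [abs_sub_comm]; congr 1; ring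
    rw [this]
  all_goals linarith

theorem mgDist_tri_E' (hG : G.Connected) (x : MGPoint G) {u v h t ht h' t' ht'} :
    mgDist G x (mpt v u h' t' ht') ≤ mgDist G x (mpt u v h t ht) + |t - (1 - t')| := by
  obtain ⟨a, b, k, s, hs, rfl⟩ := exists_mpt x
  obtain ⟨h1, h2, h3, h4⟩ := @mgDist_le_F V _ _ G a b k s hs v u h' t' ht'
  have i1 := le_abs_self (t - (1 - t'))
  have i2 := neg_abs_le (t - (1 - t'))
  rcases mgDist_cases hG (h := k) (ht := hs) (h' := h) (ht' := ht) with
    ⟨rfl, rfl, e⟩ | ⟨rfl, rfl, e⟩ | e | e | e | e <;> rw [e]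
  · exact mgDist_le_E'.trans (abs_sub_le _ _ _)
  · refine mgDist_le_E.trans ((abs_sub_le _ (1 - t) _).trans ?_)
    have : |(1 - t) - t'| = |t - (1 - t')| := by rw [abs_sub_comm]; congr 1; ring
    rw [this]
  all_goals linarith

/-- Distance through the endpoint `b` of the middle point. -/
theorem mgDist_tri_F (hG : G.Connected) (x : MGPoint G) {u v h t ht u' v' h' t' ht'} :
    mgDist G x (mpt u' v' h' t' ht') ≤
      mgDist G x (mpt u v h t ht) + (t + G.dist u u' + t') := by
  obtain ⟨a, b, k, s, hs, rfl⟩ := exists_mpt x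
  obtain ⟨h1, h2, h3, h4⟩ := @mgDist_le_F V _ _ G a b k s hs u' v' h' t' ht'
  have := ht.1; have := ht.2
  have vu : (G.dist v u : ℝ) ≤ 1 := by
    have := (SimpleGraph.dist_eq_one_iff_adj (G := G)).2 h.symm
    rw [this]; simp
  have uu : (G.dist u u : ℝ) = 0 := by simp
  have i1 := le_abs_self (s - t)
  have i2 := neg_abs_le (s - t)
  have i3 := le_abs_self (s - (1 - t))
  have i4 := neg_abs_le (s - (1 - t))
  have j1 := dist_tri4 hG a u u u'
  have j2 := dist_tri4 hG a v u u'
  have j3 := dist_tri4 hG b u u u'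
  have j4 := dist_tri4 hG b v u u'
  rcases mgDist_cases hG (h := k) (ht := hs) (h' := h) (ht' := ht) with
    ⟨rfl, rfl, e⟩ | ⟨rfl, rfl, e⟩ | e | e | e | e <;> rw [e] <;> linarith

theorem mgDist_flip {u v h t ht h' ht'} :
    mgDist G (mpt u v h t ht) (mpt v u h' (1 - t) ht') ≤ 0 := by
  refine mgDist_le_E'.trans ?_
  simp

theorem mgDist_isPM (hG : G.Connected) : IsPM (mgDist G) where
  refl x := by
    refine le_antisymm ?_ (mgDist_nonneg hG _ _)
    obtain ⟨a, b, k, s, hs, rfl⟩ := exists_mpt x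
    exact mgDist_le_E.trans (by simp)
  symm x y := le_antisymm (mgDist_le_symm hG _ _) (mgDist_le_symm hG _ _)
  tri x y z := by
    obtain ⟨u, v, h, t, ht, rfl⟩ := exists_mpt y
    obtain ⟨u', v', h', t', ht', rfl⟩ := exists_mpt z
    have fl : ∀ a b (k : G.Adj a b) s hs, mgDist G x (mpt b a k.symm (1 - s) (sub_mem_I hs)) ≤
        mgDist G x (mpt a b k s hs) := by
      intro a b k s hs
      have := mgDist_tri_E' hG x (h := k) (ht := hs) (h' := k.symm) (ht' := sub_mem_I hs)
      simpa using this
    have fl' : ∀ a b (k : G.Adj a b) s hs, mgDist G x (mpt a b k s hs) ≤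
        mgDist G x (mpt b a k.symm (1 - s) (sub_mem_I hs)) := by
      intro a b k s hs
      have := mgDist_tri_E' hG x (h := k.symm) (ht := sub_mem_I hs) (h' := k) (ht' := hs)
      simpa using this
    have f1 := fl u v h t ht
    have f2 := fl' u' v' h' t' ht'
    rcases mgDist_cases hG (h := h) (ht := ht) (h' := h') (ht' := ht') with
      ⟨rfl, rfl, e⟩ | ⟨rfl, rfl, e⟩ | e | e | e | e <;> rw [e]
    · exact mgDist_tri_E hG x
    · exact mgDist_tri_E' hG x
    · exact mgDist_tri_F hG x
    · have := mgDist_tri_F hG x (h := h) (ht := ht) (h' := h'.symm) (ht' := sub_mem_I ht')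
      linarith
    · have := mgDist_tri_F hG x (h := h.symm) (ht := sub_mem_I ht) (h' := h') (ht' := ht')
      linarith
    · have := mgDist_tri_F hG x (h := h.symm) (ht := sub_mem_I ht) (h' := h'.symm)
        (ht' := sub_mem_I ht')
      linarith

theorem IsPM.nonneg {X : Type} {D : X → X → ℝ} (hD : IsPM D) (x y : X) : 0 ≤ D x y := by
  have h1 := hD.tri x y x
  rw [hD.refl, hD.symm y x] at h1
  linarith

/-- The three local conditions which characterize the path metric as the largest one. -/
structure LocalLip (G : SimpleGraph V) (C : ℝ) (D : MGPoint G → MGPoint G → ℝ) : Prop where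
  edge : ∀ u v h s hs t ht, D (mpt u v h s hs) (mpt u v h t ht) ≤ C * |s - t|
  flip : ∀ u v h t ht, D (mpt u v h t ht) (mpt v u h.symm (1 - t) (sub_mem_I ht)) ≤ 0
  vert : ∀ u v w h k, D (mpt u v h 0 zero_mem_I) (mpt u w k 0 zero_mem_I) ≤ 0

theorem mpt_congr {u v : V} {h h' : G.Adj u v} {s t : ℝ} {hs ht} (e : s = t) :
    mpt u v h s hs = mpt u v h' t ht := by subst e; rfl

theorem universal_walk {C : ℝ} {D : MGPoint G → MGPoint G → ℝ}
    (hD : IsPM D) (hL : LocalLip G C D) {u v : V} (p : G.Walk u v) :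
    ∀ (a : V) (ha : G.Adj u a) (b : V) (hb : G.Adj v b),
      D (mpt u a ha 0 zero_mem_I) (mpt v b hb 0 zero_mem_I) ≤ C * p.length := by
  induction p with
  | nil => intro a ha b hb; simpa using hL.vert _ _ _ ha hb
  | @cons u w v k p ih =>
    intro a ha b hb
    have h1 := hL.vert u a w ha k
    have h2 := hL.edge u w k 0 zero_mem_I 1 one_mem_I
    have h3 := hL.flip u w k 1 one_mem_I
    have h4 := ih u k.symm b hb
    rw [mpt_congr (sub_self (1:ℝ)) (h' := k.symm) (ht := zero_mem_I)] at h3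
    have t1 := hD.tri (mpt u a ha 0 zero_mem_I) (mpt u w k 0 zero_mem_I) (mpt v b hb 0 zero_mem_I)
    have t2 := hD.tri (mpt u w k 0 zero_mem_I) (mpt u w k 1 one_mem_I) (mpt v b hb 0 zero_mem_I)
    have t3 := hD.tri (mpt u w k 1 one_mem_I) (mpt w u k.symm 0 zero_mem_I)
      (mpt v b hb 0 zero_mem_I)
    simp at h2
    push_cast [SimpleGraph.Walk.length_cons]
    linarith

theorem universal (hG : G.Connected) {C : ℝ} {D : MGPoint G → MGPoint G → ℝ}
    (hD : IsPM D) (hL : LocalLip G C D) (x y : MGPoint G) : D x y ≤ C * mgDist G x y := by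
  have F : ∀ u v h t ht u' v' h' t' ht', D (mpt u v h t ht) (mpt u' v' h' t' ht') ≤
      C * (t + G.dist u u' + t') := by
    intro u v h t ht u' v' h' t' ht'
    obtain ⟨p, hp⟩ := hG.exists_walk_length_eq_dist u u'
    have h1 := hL.edge u v h t ht 0 zero_mem_I
    have h2 := universal_walk hD hL p v h v' h'
    have h3 := hL.edge u' v' h' 0 zero_mem_I t' ht'
    rw [hp] at h2
    have t1 := hD.tri (mpt u v h t ht) (mpt u v h 0 zero_mem_I) (mpt u' v' h' t' ht')
    have t2 := hD.tri (mpt u v h 0 zero_mem_I) (mpt u' v' h' 0 zero_mem_I) (mpt u' v' h' t' ht')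
    simp only [sub_zero, zero_sub, abs_neg, abs_of_nonneg ht.1, abs_of_nonneg ht'.1] at h1 h3
    linarith
  obtain ⟨u, v, h, t, ht, rfl⟩ := exists_mpt x
  obtain ⟨u', v', h', t', ht', rfl⟩ := exists_mpt y
  have f1 := hL.flip u v h t ht
  have f2 := hL.flip u' v' h' t' ht'
  rw [hD.symm] at f2
  have R : ∀ z, D z (mpt u' v' h' t' ht') ≤
      D z (mpt v' u' h'.symm (1 - t') (sub_mem_I ht')) := by
    intro z
    have := hD.tri z (mpt v' u' h'.symm (1 - t') (sub_mem_I ht')) (mpt u' v' h' t' ht')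
    linarith
  have Lf : ∀ z, D (mpt u v h t ht) z ≤ D (mpt v u h.symm (1 - t) (sub_mem_I ht)) z := by
    intro z
    have := hD.tri (mpt u v h t ht) (mpt v u h.symm (1 - t) (sub_mem_I ht)) z
    linarith
  rcases mgDist_cases hG (h := h) (ht := ht) (h' := h') (ht' := ht') with
      ⟨rfl, rfl, e⟩ | ⟨rfl, rfl, e⟩ | e | e | e | e <;> rw [e]
  · exact hL.edge _ _ _ _ _ _ _
  · exact (R _).trans (hL.edge _ _ _ _ _ _ _)
  · exact F _ _ _ _ _ _ _ _ _ _
  · exact (R _).trans (F _ _ _ _ _ _ _ _ _ _)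
  · exact (Lf _).trans (F _ _ _ _ _ _ _ _ _ _)
  · exact (Lf _).trans ((R _).trans (F _ _ _ _ _ _ _ _ _ _))

theorem IsPM.comap {X Y : Type} {D : X → X → ℝ} (hD : IsPM D) (f : Y → X) :
    IsPM (fun x y => D (f x) (f y)) :=
  ⟨fun _ => hD.refl _, fun _ _ => hD.symm _ _, fun _ _ _ => hD.tri _ _ _⟩

theorem IsPM.congr_zero {X : Type} {D : X → X → ℝ} (hD : IsPM D) {x x' y y' : X}
    (hx : D x x' ≤ 0) (hy : D y y' ≤ 0) : D x y = D x' y' := by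
  have h1 := hD.tri x x' y
  have h2 := hD.tri x' y' y
  have h3 := hD.tri x' x y'
  have h4 := hD.tri x y y'
  rw [hD.symm y' y] at h2
  rw [hD.symm x' x] at h3
  linarith

end metric

section triangles

variable {V : Type} [Fintype V] [DecidableEq V] {G : SimpleGraph V}
variable {V' : Type} [Fintype V'] [DecidableEq V'] {G' : SimpleGraph V'}

/-- The set of admissible thinness constants of a triangle. -/
def thinSet (T : MGTriangle G) : Set ℝ := {d : ℝ | 0 ≤ d ∧
    (∀ s ∈ Set.Icc T.a1 T.b1,
      (∃ t ∈ Set.Icc T.a2 T.b2, mgDist G (T.g1 s) (T.g2 t) ≤ d) ∨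
      (∃ t ∈ Set.Icc T.a3 T.b3, mgDist G (T.g1 s) (T.g3 t) ≤ d)) ∧
    (∀ s ∈ Set.Icc T.a2 T.b2,
      (∃ t ∈ Set.Icc T.a1 T.b1, mgDist G (T.g2 s) (T.g1 t) ≤ d) ∨
      (∃ t ∈ Set.Icc T.a3 T.b3, mgDist G (T.g2 s) (T.g3 t) ≤ d)) ∧
    (∀ s ∈ Set.Icc T.a3 T.b3,
      (∃ t ∈ Set.Icc T.a1 T.b1, mgDist G (T.g3 s) (T.g1 t) ≤ d) ∨
      (∃ t ∈ Set.Icc T.a2 T.b2, mgDist G (T.g3 s) (T.g2 t) ≤ d))}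

theorem triangleDelta_eq (T : MGTriangle G) : triangleDelta T = sInf (thinSet T) := rfl

theorem thinSet_bddBelow (T : MGTriangle G) : BddBelow (thinSet T) :=
  ⟨0, fun _ hd => hd.1⟩

theorem card_mem_thinSet (hG : G.Connected) (T : MGTriangle G) :
    (Fintype.card V + 1 : ℝ) ∈ thinSet T := by
  refine ⟨by positivity, fun s _ => Or.inl ⟨T.a2, ⟨le_rfl, T.h2.1⟩, mgDist_lt_card hG _ _⟩,
    fun s _ => Or.inl ⟨T.a1, ⟨le_rfl, T.h1.1⟩, mgDist_lt_card hG _ _⟩,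
    fun s _ => Or.inl ⟨T.a1, ⟨le_rfl, T.h1.1⟩, mgDist_lt_card hG _ _⟩⟩

theorem triangleDelta_nonneg (T : MGTriangle G) : 0 ≤ triangleDelta T :=
  Real.sInf_nonneg fun _ hd => hd.1

theorem hypDelta_bddAbove (hG : G.Connected) :
    BddAbove {d : ℝ | ∃ T : MGTriangle G, d = triangleDelta T} := by
  refine ⟨Fintype.card V + 1, ?_⟩
  rintro d ⟨T, rfl⟩
  exact csInf_le (thinSet_bddBelow T) (card_mem_thinSet hG T)

theorem triangleDelta_le_hypDelta (hG : G.Connected) (T : MGTriangle G) :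
    triangleDelta T ≤ hypDelta G :=
  le_csSup (hypDelta_bddAbove hG) ⟨T, rfl⟩

theorem hypDelta_nonneg : 0 ≤ hypDelta G := by
  refine Real.sSup_nonneg ?_
  rintro d ⟨T, rfl⟩
  exact triangleDelta_nonneg T

theorem sim_geodesic {f : MGPoint G → MGPoint G'} {r : ℝ} (hr : 0 < r)
    (hf : ∀ x y, mgDist G' (f x) (f y) = r * mgDist G x y) {a b : ℝ} {γ : ℝ → MGPoint G}
    (h : IsMGGeodesic G a b γ) : IsMGGeodesic G' (r * a) (r * b) (fun s => f (γ (s / r))) := by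
  have mem : ∀ s ∈ Set.Icc (r * a) (r * b), s / r ∈ Set.Icc a b := by
    intro s hs
    constructor
    · rw [le_div_iff₀ hr]; linarith [hs.1]
    · rw [div_le_iff₀ hr]; linarith [hs.2]
  refine ⟨mul_le_mul_of_nonneg_left h.1 hr.le, fun s hs t ht => ?_⟩
  rw [hf, h.2 _ (mem s hs) _ (mem t ht), ← sub_div, abs_div, abs_of_pos hr]
  field_simp

/-- Image of a triangle under a similarity. -/
noncomputable def simTriangle {f : MGPoint G → MGPoint G'} {r : ℝ} (hr : 0 < r)
    (hf : ∀ x y, mgDist G' (f x) (f y) = r * mgDist G x y) (T : MGTriangle G) :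
    MGTriangle G' where
  a1 := r * T.a1
  b1 := r * T.b1
  a2 := r * T.a2
  b2 := r * T.b2
  a3 := r * T.a3
  b3 := r * T.b3
  g1 := fun s => f (T.g1 (s / r))
  g2 := fun s => f (T.g2 (s / r))
  g3 := fun s => f (T.g3 (s / r))
  h1 := sim_geodesic hr hf T.h1
  h2 := sim_geodesic hr hf T.h2
  h3 := sim_geodesic hr hf T.h3
  glue1 := by simp only [mul_div_cancel_left₀ _ hr.ne', hf, T.glue1, mul_zero]
  glue2 := by simp only [mul_div_cancel_left₀ _ hr.ne', hf, T.glue2, mul_zero]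
  glue3 := by simp only [mul_div_cancel_left₀ _ hr.ne', hf, T.glue3, mul_zero]

theorem sim_le (hG' : G'.Connected) {f : MGPoint G → MGPoint G'} {r : ℝ} (hr : 0 < r)
    (hf : ∀ x y, mgDist G' (f x) (f y) = r * mgDist G x y) :
    r * hypDelta G ≤ hypDelta G' := by
  rw [mul_comm, ← le_div_iff₀ hr]
  refine Real.sSup_le ?_ (div_nonneg hypDelta_nonneg hr.le)
  rintro d ⟨T, rfl⟩
  rw [le_div_iff₀ hr]
  refine le_trans ?_ (triangleDelta_le_hypDelta hG' (simTriangle hr hf T))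
  refine le_csInf ⟨_, card_mem_thinSet hG' (simTriangle hr hf T)⟩ ?_
  rintro d ⟨hd0, hd1, hd2, hd3⟩
  rw [← le_div_iff₀ hr]
  have mem : ∀ {a b s}, s ∈ Set.Icc a b → r * s ∈ Set.Icc (r * a) (r * b) := fun hs =>
    ⟨mul_le_mul_of_nonneg_left hs.1 hr.le, mul_le_mul_of_nonneg_left hs.2 hr.le⟩
  have mem' : ∀ {a b s}, s ∈ Set.Icc (r * a) (r * b) → s / r ∈ Set.Icc a b := by
    intro a b s hs
    constructor
    · rw [le_div_iff₀ hr]; linarith [hs.1]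
    · rw [div_le_iff₀ hr]; linarith [hs.2]
  have key : ∀ {γ σ : ℝ → MGPoint G} {a b s : ℝ},
      (∃ t ∈ Set.Icc (r * a) (r * b), mgDist G' (f (γ (r * s / r))) (f (σ (t / r))) ≤ d) →
      ∃ t ∈ Set.Icc a b, mgDist G (γ s) (σ t) ≤ d / r := by
    rintro γ σ a b s ⟨t, ht, h⟩
    refine ⟨t / r, mem' ht, ?_⟩
    rw [hf, mul_div_cancel_left₀ _ hr.ne'] at h
    rw [le_div_iff₀ hr]; linarith
  refine csInf_le (thinSet_bddBelow T) ⟨div_nonneg hd0 hr.le, fun s hs => ?_, fun s hs => ?_,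
    fun s hs => ?_⟩
  · exact (hd1 _ (mem hs)).imp key key
  · exact (hd2 _ (mem hs)).imp key key
  · exact (hd3 _ (mem hs)).imp key key

/-- Data of a "metric graph with a hair": `G'` embeds in `G × ℝ` with the ℓ¹ metric. -/
structure Hair (G : SimpleGraph V) (G' : SimpleGraph V') (ρ : MGPoint G' → MGPoint G)
    (h : MGPoint G' → ℝ) (w : MGPoint G) : Prop where
  dist_eq : ∀ x y, mgDist G' x y = mgDist G (ρ x) (ρ y) + |h x - h y|
  nonneg : ∀ x, 0 ≤ h x
  hair : ∀ x, h x = 0 ∨ mgDist G (ρ x) w = 0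

theorem hair_add {ρ : MGPoint G' → MGPoint G} {h : MGPoint G' → ℝ} {w : MGPoint G}
    (hG : G.Connected) (H : Hair G G' ρ h w) {a b : ℝ} {γ : ℝ → MGPoint G'}
    (hγ : IsMGGeodesic G' a b γ) {s t u : ℝ} (h1 : a ≤ s) (h2 : s ≤ t) (h3 : t ≤ u) (h4 : u ≤ b) :
    mgDist G (ρ (γ s)) (ρ (γ u)) = mgDist G (ρ (γ s)) (ρ (γ t)) + mgDist G (ρ (γ t)) (ρ (γ u)) ∧
    |h (γ s) - h (γ u)| = |h (γ s) - h (γ t)| + |h (γ t) - h (γ u)| := by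
  have ms : s ∈ Set.Icc a b := ⟨by linarith, by linarith⟩
  have mt : t ∈ Set.Icc a b := ⟨by linarith, by linarith⟩
  have mu : u ∈ Set.Icc a b := ⟨by linarith, by linarith⟩
  have e1 := hγ.2 s ms t mt
  have e2 := hγ.2 t mt u mu
  have e3 := hγ.2 s ms u mu
  rw [H.dist_eq, abs_of_nonpos (a := s - t) (by linarith)] at e1
  rw [H.dist_eq, abs_of_nonpos (a := t - u) (by linarith)] at e2
  rw [H.dist_eq, abs_of_nonpos (a := s - u) (by linarith)] at e3
  have i1 := (mgDist_isPM hG).tri (ρ (γ s)) (ρ (γ t)) (ρ (γ u))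
  have i2 := abs_sub_le (h (γ s)) (h (γ t)) (h (γ u))
  constructor <;> linarith

theorem hair_between {ρ : MGPoint G' → MGPoint G} {h : MGPoint G' → ℝ} {w : MGPoint G}
    (hG : G.Connected) (H : Hair G G' ρ h w) {a b : ℝ} {γ : ℝ → MGPoint G'}
    (hγ : IsMGGeodesic G' a b γ) {s : ℝ} (hs : s ∈ Set.Icc a b) :
    h (γ s) ∈ Set.uIcc (h (γ b)) (h (γ a)) := by
  have e := (hair_add hG H hγ le_rfl hs.1 hs.2 le_rfl).2
  rw [Set.mem_uIcc]
  rcases le_total (h (γ a)) (h (γ s)) with h1 | h1 <;>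
  rcases le_total (h (γ s)) (h (γ b)) with h2 | h2 <;>
  rcases le_total (h (γ a)) (h (γ b)) with h3 | h3 <;>
  simp only [abs_of_nonpos (sub_nonpos.2 h1), abs_of_nonneg (sub_nonneg.2 h1),
    abs_of_nonpos (sub_nonpos.2 h2), abs_of_nonneg (sub_nonneg.2 h2),
    abs_of_nonpos (sub_nonpos.2 h3), abs_of_nonneg (sub_nonneg.2 h3)] at e <;>
  first
  | exact Or.inl ⟨by linarith, by linarith⟩
  | exact Or.inr ⟨by linarith, by linarith⟩

theorem hair_lip {ρ : MGPoint G' → MGPoint G} {h : MGPoint G' → ℝ} {w : MGPoint G}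
    (hG : G.Connected) (H : Hair G G' ρ h w) {a b : ℝ} {γ : ℝ → MGPoint G'}
    (hγ : IsMGGeodesic G' a b γ) : ContinuousOn (fun s => h (γ s)) (Set.Icc a b) := by
  have : LipschitzOnWith 1 (fun s => h (γ s)) (Set.Icc a b) := by
    refine LipschitzOnWith.of_dist_le_mul fun s hs t ht => ?_
    have e := hγ.2 s hs t ht
    rw [H.dist_eq] at e
    have := mgDist_nonneg hG (ρ (γ s)) (ρ (γ t))
    simp only [Real.dist_eq, NNReal.coe_one, one_mul]
    linarith
  exact this.continuousOn

/-- The projection of a geodesic, reparametrized, is a geodesic. -/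
theorem hair_project {ρ : MGPoint G' → MGPoint G} {h : MGPoint G' → ℝ} {w : MGPoint G}
    (hG : G.Connected) (H : Hair G G' ρ h w) {a b : ℝ} {γ : ℝ → MGPoint G'}
    (hγ : IsMGGeodesic G' a b γ) :
    ∃ (l : ℝ) (σ : ℝ → MGPoint G), IsMGGeodesic G 0 l σ ∧
      mgDist G (σ 0) (ρ (γ a)) ≤ 0 ∧ mgDist G (σ l) (ρ (γ b)) ≤ 0 ∧
      (∀ s ∈ Set.Icc a b, ∃ k ∈ Set.Icc 0 l, mgDist G (σ k) (ρ (γ s)) ≤ 0) ∧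
      (∀ k ∈ Set.Icc 0 l, ∃ s ∈ Set.Icc a b, mgDist G (σ k) (ρ (γ s)) ≤ 0) := by
  have PM := mgDist_isPM hG
  set L : ℝ → ℝ := fun s => mgDist G (ρ (γ a)) (ρ (γ s)) with hL
  have L0 : L a = 0 := PM.refl _
  have dL : ∀ s ∈ Set.Icc a b, ∀ t ∈ Set.Icc a b,
      mgDist G (ρ (γ s)) (ρ (γ t)) = |L s - L t| := by
    have : ∀ s ∈ Set.Icc a b, ∀ t ∈ Set.Icc a b, s ≤ t →
        mgDist G (ρ (γ s)) (ρ (γ t)) = |L s - L t| := by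
      intro s hs t ht hst
      have e := (hair_add hG H hγ le_rfl hs.1 hst ht.2).1
      have := mgDist_nonneg hG (ρ (γ s)) (ρ (γ t))
      rw [abs_sub_comm, abs_of_nonneg] <;> simp only [hL] <;> linarith
    intro s hs t ht
    rcases le_total s t with hst | hst
    · exact this s hs t ht hst
    · rw [PM.symm, abs_sub_comm]; exact this t ht s hs hst
  have Lc : ContinuousOn L (Set.Icc a b) := by
    have : LipschitzOnWith 1 L (Set.Icc a b) := by
      refine LipschitzOnWith.of_dist_le_mul fun s hs t ht => ?_
      have e := hγ.2 s hs t ht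
      rw [H.dist_eq, dL s hs t ht] at e
      have := abs_nonneg (h (γ s) - h (γ t))
      simp only [Real.dist_eq, NNReal.coe_one, one_mul]
      linarith
    exact this.continuousOn
  have Lnn : ∀ s, 0 ≤ L s := fun s => mgDist_nonneg hG _ _
  have Lle : ∀ s ∈ Set.Icc a b, L s ≤ L b := by
    intro s hs
    have e := (hair_add hG H hγ le_rfl hs.1 hs.2 le_rfl).1
    have := mgDist_nonneg hG (ρ (γ s)) (ρ (γ b))
    simp only [hL]; linarith
  have ivt : ∀ k ∈ Set.Icc 0 (L b), ∃ s ∈ Set.Icc a b, L s = k := by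
    intro k hk
    have := intermediate_value_Icc hγ.1 Lc
    rw [L0] at this
    exact this hk
  choose! S hS1 hS2 using ivt
  have ma : a ∈ Set.Icc a b := ⟨le_rfl, hγ.1⟩
  have mb : b ∈ Set.Icc a b := ⟨hγ.1, le_rfl⟩
  have near : ∀ s ∈ Set.Icc a b, mgDist G (ρ (γ (S (L s)))) (ρ (γ s)) ≤ 0 := by
    intro s hs
    have hk : L s ∈ Set.Icc 0 (L b) := ⟨Lnn s, Lle s hs⟩
    rw [dL _ (hS1 _ hk) s hs, hS2 _ hk]; simp
  refine ⟨L b, fun k => ρ (γ (S k)), ⟨Lnn b, ?_⟩, ?_, near b mb, ?_, ?_⟩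
  · intro s hs t ht
    rw [dL _ (hS1 _ hs) _ (hS1 _ ht), hS2 _ hs, hS2 _ ht]
  · have := near a ma
    rwa [L0] at this
  · intro s hs
    exact ⟨L s, ⟨Lnn s, Lle s hs⟩, near s hs⟩
  · intro k hk
    exact ⟨S k, hS1 k hk, PM.refl _ ▸ le_rfl⟩

theorem hair_side {ρ : MGPoint G' → MGPoint G} {h : MGPoint G' → ℝ} {w : MGPoint G}
    (hG : G.Connected) (H : Hair G G' ρ h w) {a1 b1 a2 b2 a3 b3 : ℝ}
    {γ1 γ2 γ3 : ℝ → MGPoint G'}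
    (h1 : IsMGGeodesic G' a1 b1 γ1) (h2 : IsMGGeodesic G' a2 b2 γ2)
    (h3 : IsMGGeodesic G' a3 b3 γ3) (g1 : h (γ1 b1) = h (γ2 a2)) (g2 : h (γ2 b2) = h (γ3 a3))
    (g3 : h (γ3 b3) = h (γ1 a1)) {d ε : ℝ} (hd : 0 ≤ d) (hε : 0 < ε) {s : ℝ}
    (hs : s ∈ Set.Icc a1 b1)
    (hT : (∃ t ∈ Set.Icc a2 b2, mgDist G (ρ (γ1 s)) (ρ (γ2 t)) ≤ d) ∨
      (∃ t ∈ Set.Icc a3 b3, mgDist G (ρ (γ1 s)) (ρ (γ3 t)) ≤ d)) :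
    (∃ t ∈ Set.Icc a2 b2, mgDist G' (γ1 s) (γ2 t) ≤ d + ε) ∨
      (∃ t ∈ Set.Icc a3 b3, mgDist G' (γ1 s) (γ3 t) ≤ d + ε) := by
  have PM := mgDist_isPM hG
  -- the union of the two other sides, as a set of points
  set U : Set (MGPoint G') := γ2 '' Set.Icc a2 b2 ∪ γ3 '' Set.Icc a3 b3 with hU
  have m2 : γ2 a2 ∈ U := Or.inl ⟨a2, ⟨le_rfl, h2.1⟩, rfl⟩
  have m2' : γ2 b2 ∈ U := Or.inl ⟨b2, ⟨h2.1, le_rfl⟩, rfl⟩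
  have m3 : γ3 b3 ∈ U := Or.inr ⟨b3, ⟨h3.1, le_rfl⟩, rfl⟩
  have conn : (h '' U).OrdConnected := by
    rw [← isPreconnected_iff_ordConnected]
    rw [hU, Set.image_union, Set.image_image, Set.image_image]
    refine IsPreconnected.union (h (γ2 b2)) ⟨b2, ⟨h2.1, le_rfl⟩, rfl⟩
      ⟨a3, ⟨le_rfl, h3.1⟩, g2.symm⟩ ?_ ?_
    · exact isPreconnected_Icc.image _ (hair_lip hG H h2)
    · exact isPreconnected_Icc.image _ (hair_lip hG H h3)
  suffices hh : ∃ y ∈ U, mgDist G' (γ1 s) y ≤ d + ε by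
    obtain ⟨y, ⟨t, ht, rfl⟩ | ⟨t, ht, rfl⟩, hy⟩ := hh
    · exact Or.inl ⟨t, ht, hy⟩
    · exact Or.inr ⟨t, ht, hy⟩
  have hT' : ∃ y ∈ U, mgDist G (ρ (γ1 s)) (ρ y) ≤ d := by
    rcases hT with ⟨t, ht, h⟩ | ⟨t, ht, h⟩
    · exact ⟨_, Or.inl ⟨t, ht, rfl⟩, h⟩
    · exact ⟨_, Or.inr ⟨t, ht, rfl⟩, h⟩
  have bet := hair_between hG H h1 hs
  rw [g1, ← g3] at bet
  have hq : h (γ1 s) ∈ h '' U := conn.uIcc_subset ⟨_, m2, rfl⟩ ⟨_, m3, rfl⟩ bet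
  rcases (H.nonneg (γ1 s)).eq_or_lt with h0 | hpos
  · obtain ⟨y, hy, hyd⟩ := hT'
    rcases (H.nonneg y).eq_or_lt with y0 | ypos
    · refine ⟨y, hy, ?_⟩
      rw [H.dist_eq, ← h0, ← y0]; simp; linarith
    · set c := min ε (h y) with hc
      have cpos : 0 < c := lt_min hε ypos
      have : c ∈ h '' U := conn.out hq ⟨y, hy, rfl⟩ ⟨by rw [← h0]; exact cpos.le, min_le_right _ _⟩
      obtain ⟨z, hz, hzc⟩ := this
      refine ⟨z, hz, ?_⟩
      have w1 := (H.hair y).resolve_left ypos.ne'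
      have w2 := (H.hair z).resolve_left (by rw [hzc]; exact cpos.ne')
      have e := PM.tri (ρ (γ1 s)) (ρ y) (ρ z)
      have e2 := PM.tri (ρ y) w (ρ z)
      rw [PM.symm w] at e2
      rw [H.dist_eq, ← h0, hzc, zero_sub, abs_neg, abs_of_pos cpos]
      have : c ≤ ε := min_le_left _ _
      linarith
  · obtain ⟨z, hz, hzc⟩ := hq
    refine ⟨z, hz, ?_⟩
    have w1 := (H.hair (γ1 s)).resolve_left hpos.ne'
    have w2 := (H.hair z).resolve_left (by rw [hzc]; exact hpos.ne')
    have e2 := PM.tri (ρ (γ1 s)) w (ρ z)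
    rw [PM.symm w] at e2
    rw [H.dist_eq, hzc, sub_self, abs_zero]
    linarith

theorem hair_le {ρ : MGPoint G' → MGPoint G} {h : MGPoint G' → ℝ} {w : MGPoint G}
    (hG : G.Connected) (H : Hair G G' ρ h w) : hypDelta G' ≤ hypDelta G := by
  have PM := mgDist_isPM hG
  refine Real.sSup_le ?_ hypDelta_nonneg
  rintro d ⟨T, rfl⟩
  obtain ⟨l1, σ1, hσ1, s1, e1, A1, B1⟩ := hair_project hG H T.h1
  obtain ⟨l2, σ2, hσ2, s2, e2, A2, B2⟩ := hair_project hG H T.h2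
  obtain ⟨l3, σ3, hσ3, s3, e3, A3, B3⟩ := hair_project hG H T.h3
  have gl : ∀ {x y : MGPoint G'}, mgDist G' x y = 0 → mgDist G (ρ x) (ρ y) = 0 ∧ h x = h y := by
    intro x y hxy
    rw [H.dist_eq] at hxy
    have i1 := mgDist_nonneg hG (ρ x) (ρ y)
    have i2 := abs_nonneg (h x - h y)
    refine ⟨by linarith, ?_⟩
    have : |h x - h y| = 0 := by linarith
    exact sub_eq_zero.1 (abs_eq_zero.1 this)
  obtain ⟨k1, k1'⟩ := gl T.glue1
  obtain ⟨k2, k2'⟩ := gl T.glue2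
  obtain ⟨k3, k3'⟩ := gl T.glue3
  let S : MGTriangle G :=
    { a1 := 0, b1 := l1, a2 := 0, b2 := l2, a3 := 0, b3 := l3, g1 := σ1, g2 := σ2, g3 := σ3,
      h1 := hσ1, h2 := hσ2, h3 := hσ3,
      glue1 := by rw [PM.congr_zero e1 s2, k1]
      glue2 := by rw [PM.congr_zero e2 s3, k2]
      glue3 := by rw [PM.congr_zero e3 s1, k3] }
  refine le_trans ?_ (triangleDelta_le_hypDelta hG S)
  refine le_csInf ⟨_, card_mem_thinSet hG S⟩ ?_
  rintro d ⟨hd0, hd1, hd2, hd3⟩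
  refine le_of_forall_pos_le_add fun ε hε => ?_
  have pull : ∀ {a b l a' b' l' : ℝ} {γ γ' : ℝ → MGPoint G'} {σ σ' : ℝ → MGPoint G},
      (∀ k ∈ Set.Icc 0 l', ∃ s ∈ Set.Icc a' b', mgDist G (σ' k) (ρ (γ' s)) ≤ 0) →
      ∀ {s k : ℝ}, mgDist G (σ k) (ρ (γ s)) ≤ 0 →
      (∃ t ∈ Set.Icc 0 l', mgDist G (σ k) (σ' t) ≤ d) →
      ∃ t ∈ Set.Icc a' b', mgDist G (ρ (γ s)) (ρ (γ' t)) ≤ d := by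
    rintro a b l a' b' l' γ γ' σ σ' B' s k hk ⟨t, ht, hd⟩
    obtain ⟨u, hu, hu'⟩ := B' t ht
    exact ⟨u, hu, (PM.congr_zero hk hu').symm.le.trans hd⟩
  refine csInf_le (thinSet_bddBelow T) ⟨by linarith, fun s hs => ?_, fun s hs => ?_,
    fun s hs => ?_⟩
  · obtain ⟨k, hk, hk'⟩ := A1 s hs
    refine hair_side hG H T.h1 T.h2 T.h3 k1' k2' k3' hd0 hε hs ?_
    exact (hd1 k hk).imp (pull (a := 0) (b := 0) (l := 0) B2 hk')
      (pull (a := 0) (b := 0) (l := 0) B3 hk')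
  · obtain ⟨k, hk, hk'⟩ := A2 s hs
    refine (hair_side hG H T.h2 T.h3 T.h1 k2' k3' k1' hd0 hε hs ?_).symm
    exact (hd2 k hk).symm.imp (pull (a := 0) (b := 0) (l := 0) B3 hk')
      (pull (a := 0) (b := 0) (l := 0) B1 hk')
  · obtain ⟨k, hk, hk'⟩ := A3 s hs
    refine hair_side hG H T.h3 T.h1 T.h2 k3' k1' k2' hd0 hε hs ?_
    exact (hd3 k hk).imp (pull (a := 0) (b := 0) (l := 0) B1 hk')
      (pull (a := 0) (b := 0) (l := 0) B2 hk')

end triangles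

section cycles

/-- The set of lengths of cycles. -/
def cycLens {V : Type} (G : SimpleGraph V) : Set ℕ :=
  {n : ℕ | ∃ (a : V) (w : G.Walk a a), w.IsCycle ∧ w.length = n}

/-- A cycle of length `l`, as a periodic sequence of vertices. -/
structure IsCyc {V : Type} (G : SimpleGraph V) (l : ℕ) (f : ℕ → V) : Prop where
  three : 3 ≤ l
  adj : ∀ i, G.Adj (f i) (f (i + 1))
  inj : ∀ i j, f i = f j ↔ i ≡ j [MOD l]

theorem IsCyc.nb {V : Type} {G : SimpleGraph V} {l : ℕ} {f : ℕ → V} (h : IsCyc G l f) (i : ℕ) :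
    f i ≠ f (i + 2) := by
  intro e
  have := (h.inj _ _).1 e
  have h2 := (Nat.modEq_iff_dvd' (by omega : i ≤ i + 2)).1 this
  have := Nat.le_of_dvd (by omega) h2
  have := h.three
  omega

theorem IsCyc.edge_inj {V : Type} {G : SimpleGraph V} {l : ℕ} {f : ℕ → V} (h : IsCyc G l f)
    {a b : ℕ} (e : s(f a, f (a + 1)) = s(f b, f (b + 1))) : a ≡ b [MOD l] := by
  rw [Sym2.eq_iff] at e
  rcases e with ⟨e, -⟩ | ⟨e1, e2⟩
  · exact (h.inj _ _).1 e
  · exfalso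
    have h1 := (h.inj _ _).1 e1
    have h2 := (h.inj _ _).1 e2
    have h3 : b + 1 + 1 ≡ b [MOD l] := (h1.symm.add_right 1).trans h2
    exact h.nb b ((h.inj _ _).2 h3.symm)

/-- The walk along a sequence. -/
def seqWalk {V : Type} {G : SimpleGraph V} (f : ℕ → V) (h : ∀ i, G.Adj (f i) (f (i + 1))) :
    ∀ n, G.Walk (f 0) (f n)
  | 0 => .nil
  | n + 1 => (seqWalk f h n).concat (h n)

theorem seqWalk_support {V : Type} {G : SimpleGraph V} (f : ℕ → V)
    (h : ∀ i, G.Adj (f i) (f (i + 1))) (n : ℕ) :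
    (seqWalk f h n).support = (List.range (n + 1)).map f := by
  induction n with
  | zero => simp [seqWalk]
  | succ n ih =>
    rw [seqWalk, SimpleGraph.Walk.support_concat, ih, List.range_succ (n := n + 1)]
    simp

theorem seqWalk_edges {V : Type} {G : SimpleGraph V} (f : ℕ → V)
    (h : ∀ i, G.Adj (f i) (f (i + 1))) (n : ℕ) :
    (seqWalk f h n).edges = (List.range n).map (fun i => s(f i, f (i + 1))) := by
  induction n with
  | zero => simp [seqWalk]
  | succ n ih =>
    rw [seqWalk, SimpleGraph.Walk.edges_concat, ih, List.range_succ (n := n)]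
    simp

theorem seqWalk_length {V : Type} {G : SimpleGraph V} (f : ℕ → V)
    (h : ∀ i, G.Adj (f i) (f (i + 1))) (n : ℕ) :
    (seqWalk f h n).length = n := by
  induction n with
  | zero => simp [seqWalk]
  | succ n ih => rw [seqWalk, SimpleGraph.Walk.length_concat, ih]

theorem mem_cycLens {V : Type} {G : SimpleGraph V} {l : ℕ} :
    l ∈ cycLens G ↔ ∃ f, IsCyc G l f := by
  constructor
  · rintro ⟨a, w, hw, rfl⟩
    have h3 := hw.three_le_length
    refine ⟨fun i => w.getVert (i % w.length), h3, fun i => ?_, fun i j => ?_⟩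
    · have hi : i % w.length < w.length := Nat.mod_lt _ (by omega)
      have hadj := w.adj_getVert_succ hi
      rcases Nat.lt_or_ge (i % w.length + 1) w.length with h | h
      · have : (i + 1) % w.length = i % w.length + 1 := by
          rw [Nat.add_mod, Nat.mod_eq_of_lt (a := 1) (by omega), Nat.mod_eq_of_lt h]
        simp only [this]; exact hadj
      · have h' : i % w.length + 1 = w.length := by omega
        have : (i + 1) % w.length = 0 := by
          rw [Nat.add_mod, Nat.mod_eq_of_lt (a := 1) (by omega), h', Nat.mod_self]
        rw [h', SimpleGraph.Walk.getVert_length] at hadj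
        simp only [this, SimpleGraph.Walk.getVert_zero]; exact hadj
    · constructor
      · intro e
        have h1 : i % w.length < w.length := Nat.mod_lt _ (by omega)
        have h2 : j % w.length < w.length := Nat.mod_lt _ (by omega)
        exact hw.getVert_injOn' (by simp only [Set.mem_setOf_eq]; omega)
          (by simp only [Set.mem_setOf_eq]; omega) e
      · intro e
        exact congrArg w.getVert e
  · rintro ⟨f, hf⟩
    have h3 := hf.three
    obtain ⟨k, rfl⟩ : ∃ k, l = k + 1 := ⟨l - 1, by omega⟩
    have e0 : f (k + 1) = f 0 := (hf.inj _ _).2 (by simp [Nat.ModEq])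
    let q := seqWalk (G := G) (fun i => f (i + 1)) (fun i => hf.adj (i + 1)) k
    have hq : (q.copy rfl e0).IsPath := by
      rw [SimpleGraph.Walk.isPath_def, SimpleGraph.Walk.support_copy, seqWalk_support]
      refine List.Nodup.map_on ?_ List.nodup_range
      intro x hx y hy e
      rw [List.mem_range] at hx hy
      have := Nat.ModEq.add_right_cancel' 1 ((hf.inj _ _).1 e)
      exact Nat.ModEq.eq_of_lt_of_lt this hx hy
    refine ⟨f 0, SimpleGraph.Walk.cons (hf.adj 0) (q.copy rfl e0), ?_, ?_⟩
    · rw [SimpleGraph.Walk.cons_isCycle_iff]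
      refine ⟨hq, ?_⟩
      rw [SimpleGraph.Walk.edges_copy, seqWalk_edges]
      intro hm
      obtain ⟨i, hi, e⟩ := List.mem_map.1 hm
      rw [List.mem_range] at hi
      have := hf.edge_inj e
      have := Nat.ModEq.eq_of_lt_of_lt this (by omega) (by omega)
      omega
    · rw [SimpleGraph.Walk.length_cons, SimpleGraph.Walk.length_copy, seqWalk_length]

theorem girth_eq_sInf {V : Type} (G : SimpleGraph V) : G.girth = sInf (cycLens G) := by
  by_cases h : G.IsAcyclic
  · rw [SimpleGraph.girth_eq_zero.2 h]
    have : cycLens G = ∅ := by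
      ext n; simp only [cycLens, Set.mem_setOf_eq, Set.mem_empty_iff_false, iff_false]
      rintro ⟨a, w, hw, -⟩
      exact h w hw
    rw [this]; simp
  · obtain ⟨a, w, hw, e⟩ := SimpleGraph.exists_girth_eq_length.2 h
    apply le_antisymm
    · refine le_csInf ⟨_, a, w, hw, rfl⟩ ?_
      rintro n ⟨b, p, hp, rfl⟩
      exact SimpleGraph.girth_le_length hp
    · rw [e]; exact Nat.sInf_le ⟨a, w, hw, rfl⟩

theorem circumference_eq {V : Type} (G : SimpleGraph V) : circumference G = sSup (cycLens G) := rfl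

theorem cycLens_bdd {V : Type} [Fintype V] (G : SimpleGraph V) : BddAbove (cycLens G) := by
  refine ⟨Fintype.card V, fun l hl => ?_⟩
  obtain ⟨f, hf⟩ := mem_cycLens.1 hl
  have : Function.Injective (fun i : Fin l => f i) := by
    intro i j e
    exact Fin.ext (Nat.ModEq.eq_of_lt_of_lt ((hf.inj _ _).1 e) i.2 j.2)
  simpa using Fintype.card_le_of_injective _ this

theorem sInf_scale (S : Set ℕ) (r : ℕ) : sInf ((fun x => r * x) '' S) = r * sInf S := by
  rcases S.eq_empty_or_nonempty with rfl | h
  · simp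
  · apply le_antisymm
    · exact Nat.sInf_le ⟨_, Nat.sInf_mem h, rfl⟩
    · refine le_csInf (h.image _) ?_
      rintro _ ⟨x, hx, rfl⟩
      exact Nat.mul_le_mul_left _ (Nat.sInf_le hx)

theorem sSup_scale (S : Set ℕ) (hS : BddAbove S) (r : ℕ) :
    sSup ((fun x => r * x) '' S) = r * sSup S := by
  rcases S.eq_empty_or_nonempty with rfl | h
  · simp
  · apply le_antisymm
    · refine csSup_le (h.image _) ?_
      rintro _ ⟨x, hx, rfl⟩
      exact Nat.mul_le_mul_left _ (le_csSup hS hx)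
    · refine le_csSup ?_ ⟨_, Nat.sSup_mem h hS, rfl⟩
      obtain ⟨b, hb⟩ := hS
      refine ⟨r * b, ?_⟩
      rintro _ ⟨x, hx, rfl⟩
      exact Nat.mul_le_mul_left _ (hb hx)

theorem cyc_map {V W : Type} {G : SimpleGraph V} {H : SimpleGraph W} (e : V → W)
    (he : Function.Injective e) (hadj : ∀ u v, G.Adj u v → H.Adj (e u) (e v)) :
    cycLens G ⊆ cycLens H := by
  intro l hl
  obtain ⟨f, hf⟩ := mem_cycLens.1 hl
  refine mem_cycLens.2 ⟨fun i => e (f i), hf.three, fun i => hadj _ _ (hf.adj i), fun i j => ?_⟩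
  rw [he.eq_iff, hf.inj]

end cycles

section subdivision

/-- Barycentric coordinates (times `r`) of the `i`-th subdivision vertex of the edge `[u,v]`. -/
def Qv {V : Type} [DecidableEq V] (r : ℕ) (u v : V) (i : ℕ) : V → ℕ :=
  fun x => (if x = u then r - i else 0) + (if x = v then i else 0)

/-- The vertices of the `r`-fold subdivision. -/
def SubV {V : Type} [DecidableEq V] (G : SimpleGraph V) (r : ℕ) : Type :=
  {f : V → ℕ // ∃ u v i, (u = v ∨ G.Adj u v) ∧ i ≤ r ∧ f = Qv r u v i}

variable {V : Type} [DecidableEq V] {G : SimpleGraph V} {r : ℕ}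

theorem Qv_flip {u v : V} {i : ℕ} (hi : i ≤ r) : Qv r u v i = Qv r v u (r - i) := by
  funext x; simp only [Qv]
  rw [Nat.sub_sub_self hi, add_comm]

theorem Qv_zero (u v w : V) : Qv r u v 0 = Qv r u w 0 := by
  funext x; simp [Qv]

theorem Qv_top (u v w : V) : Qv r u v r = Qv r v w 0 := by
  funext x; simp [Qv]

theorem Qv_inj {u v a b : V} {i j : ℕ} (huv : u ≠ v) (hab : a ≠ b) (hi : 0 < i) (hi' : i < r)
    (hj : j ≤ r) (h : Qv r u v i = Qv r a b j) :
    (a = u ∧ b = v ∧ j = i) ∨ (a = v ∧ b = u ∧ j = r - i) := by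
  have h1 := congrFun h u
  have h2 := congrFun h v
  have h3 := congrFun h a
  have h4 := congrFun h b
  simp only [Qv, if_true, if_neg huv, if_neg huv.symm, if_neg hab, if_neg hab.symm] at h1 h2 h3 h4
  by_cases e1 : u = a
  · subst e1
    by_cases e2 : v = b
    · subst e2; left; refine ⟨rfl, rfl, ?_⟩
      simp [huv, huv.symm] at *; omega
    · simp [huv.symm, e2] at h2; omega
  · by_cases e2 : u = b
    · subst e2
      by_cases e3 : v = a
      · subst e3; right; refine ⟨rfl, rfl, ?_⟩
        simp [huv, huv.symm] at *; omega
      · simp [huv.symm, e3] at h2; omega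
    · simp [e1, e2] at h1; omega

theorem Qv_vert {u w a b : V} {j : ℕ} (hab : a ≠ b) (hj : j < r)
    (h : Qv r a b j = Qv r u w 0) : j = 0 ∧ a = u := by
  have h3 := congrFun h a
  have h4 := congrFun h b
  simp only [Qv, if_true, if_neg hab, if_neg hab.symm] at h3 h4
  by_cases e : a = u
  · refine ⟨?_, e⟩
    subst e
    simp [hab.symm] at h4; exact h4
  · simp [e] at h3; omega

theorem Qv_vert_inj {u w u' w' : V} (hr : 1 ≤ r) (h : Qv r u w 0 = Qv r u' w' 0) : u = u' := by
  have h1 := congrFun h u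
  by_contra e
  simp [Qv, e] at h1; omega

/-- The `r`-fold subdivision of `G`. -/
def subG (G : SimpleGraph V) (r : ℕ) : SimpleGraph (SubV G r) where
  Adj a b := ∃ u v i, G.Adj u v ∧ i < r ∧ a.1 = Qv r u v i ∧ b.1 = Qv r u v (i + 1)
  symm := ⟨by
    rintro a b ⟨u, v, i, h, hi, ha, hb⟩
    refine ⟨v, u, r - (i + 1), h.symm, by omega, ?_, ?_⟩
    · rw [hb, Qv_flip (by omega)]
    · rw [ha, Qv_flip (by omega)]; congr 1; omega⟩
  loopless := ⟨by
    rintro a ⟨u, v, i, h, hi, ha, hb⟩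
    rw [ha] at hb
    have := congrFun hb v
    simp [Qv, h.ne.symm] at this⟩

/-- Subdivision vertex on an edge. -/
def sqv (r : ℕ) (u v : V) (h : G.Adj u v) (i : ℕ) (hi : i ≤ r) : SubV G r :=
  ⟨Qv r u v i, u, v, i, Or.inr h, hi, rfl⟩

/-- Original vertices. -/
def ov (G : SimpleGraph V) (r : ℕ) (u : V) : SubV G r :=
  ⟨Qv r u u 0, u, u, 0, Or.inl rfl, Nat.zero_le _, rfl⟩

theorem sub_adj {u v : V} (h : G.Adj u v) {i : ℕ} (hi : i < r) :
    (subG G r).Adj (sqv r u v h i hi.le) (sqv r u v h (i + 1) hi) :=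
  ⟨u, v, i, h, hi, rfl, rfl⟩

theorem sub_nbr {u v : V} (h : G.Adj u v) {i : ℕ} (hi : 0 < i) (hi' : i < r) {a b : SubV G r}
    (ha : a.1 = Qv r u v i) (hab : (subG G r).Adj a b) :
    b.1 = Qv r u v (i + 1) ∨ b.1 = Qv r u v (i - 1) := by
  obtain ⟨x, y, j, hxy, hj, ea, eb⟩ := hab
  rw [ha] at ea
  rcases Qv_inj h.ne hxy.ne hi hi' hj.le ea with ⟨rfl, rfl, rfl⟩ | ⟨rfl, rfl, rfl⟩
  · exact Or.inl eb
  · right; rw [eb, Qv_flip (by omega)]; congr 1; omega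

theorem cyc_sub_fwd (hr : 1 ≤ r) {l : ℕ} (hl : l ∈ cycLens G) : r * l ∈ cycLens (subG G r) := by
  obtain ⟨f, hf⟩ := mem_cycLens.1 hl
  have h3 := hf.three
  refine mem_cycLens.2 ⟨fun k => sqv r (f (k / r)) (f (k / r + 1)) (hf.adj _) (k % r)
    (Nat.mod_lt _ hr).le, by nlinarith, fun k => ?_, fun k m => ?_⟩
  · refine ⟨f (k / r), f (k / r + 1), k % r, hf.adj _, Nat.mod_lt _ hr, rfl, ?_⟩
    simp only [sqv]
    have hk : k % r < r := Nat.mod_lt _ hr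
    have hd := Nat.div_add_mod k r
    rcases Nat.lt_or_ge (k % r + 1) r with h | h
    · have e1 : (k + 1) / r = k / r := by
        rw [Nat.div_eq_iff (by omega)]
        rw [mul_comm (k / r)]; constructor <;> omega
      have e2 : (k + 1) % r = k % r + 1 := by
        have := Nat.div_add_mod (k + 1) r
        rw [e1] at this; omega
      rw [e1, e2]
    · have e0 : k + 1 = r * (k / r + 1) := by rw [mul_add]; omega
      have e1 : (k + 1) / r = k / r + 1 := by
        conv_lhs => rw [e0]
        exact Nat.mul_div_cancel_left _ hr
      have e2 : (k + 1) % r = 0 := by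
        conv_lhs => rw [e0]
        exact Nat.mul_mod_right _ _
      rw [e1, e2, show k % r + 1 = r by omega]
      exact (Qv_top _ _ _).symm
  · rw [Nat.ModEq, Nat.mod_mul, Nat.mod_mul]
    have hk : k % r < r := Nat.mod_lt _ hr
    have hm : m % r < r := Nat.mod_lt _ hr
    constructor
    · intro e
      have e := congrArg Subtype.val e
      simp only [sqv] at e
      rcases Nat.eq_zero_or_pos (m % r) with h0 | h0
      · rw [h0] at e
        obtain ⟨e1, e2⟩ := Qv_vert (hf.adj _).ne hk e
        rw [e1, h0, show k / r % l = m / r % l from (hf.inj _ _).1 e2]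
      · have ee : s(f (k / r), f (k / r + 1)) = s(f (m / r), f (m / r + 1)) := by
          rcases Qv_inj (hf.adj _).ne (hf.adj _).ne h0 hm hk.le e.symm with h | h
          · rw [h.1, h.2.1]
          · rw [h.1, h.2.1, Sym2.eq_swap]
        have hmod := hf.edge_inj ee
        have a1 := (hf.inj _ _).2 hmod
        have a2 := (hf.inj _ _).2 (hmod.add_right 1)
        rw [a1, a2] at e
        have : k % r = m % r := by
          have := congrFun e (f (m / r + 1))
          simpa [Qv, (hf.adj (m / r)).ne.symm] using this
        rw [this, show k / r % l = m / r % l from hmod]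
    · intro e
      have e1 : k % r = m % r := by
        have := congrArg (· % r) e
        simpa [Nat.add_mul_mod_self_left] using this
      have e2 : k / r ≡ m / r [MOD l] := by
        rw [e1] at e
        exact Nat.eq_of_mul_eq_mul_left hr (Nat.add_left_cancel e)
      apply Subtype.ext
      simp only [sqv]
      rw [(hf.inj _ _).2 e2, (hf.inj _ _).2 (e2.add_right 1), e1]

theorem cyc_sub_run {L : ℕ} {f : ℕ → SubV G r} (hf : IsCyc (subG G r) L f) {m i : ℕ} {u v : V}
    (h : G.Adj u v) (h0 : (f m).1 = Qv r u v i) (h1 : (f (m + 1)).1 = Qv r u v (i + 1)) :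
    ∀ j, i + j ≤ r → (f (m + j)).1 = Qv r u v (i + j) := by
  intro j
  induction j using Nat.strong_induction_on with
  | _ j ih =>
    intro hj
    match j, ih, hj with
    | 0, _, _ => simpa using h0
    | 1, _, _ => exact h1
    | j + 2, ih, hj =>
      have a := ih (j + 1) (by omega) (by omega)
      have b := ih j (by omega) (by omega)
      rcases sub_nbr h (i := i + (j + 1)) (by omega) (by omega) a (hf.adj (m + (j + 1))) with c | c
      · exact c
      · exfalso
        apply hf.nb (m + j)
        apply Subtype.ext
        rw [b]
        exact c.symm

theorem cyc_sub_bwd (hr : 1 ≤ r) {L : ℕ} (hL : L ∈ cycLens (subG G r)) :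
    ∃ l ∈ cycLens G, L = r * l := by
  obtain ⟨f, hf⟩ := mem_cycLens.1 hL
  have h3 := hf.three
  -- an original vertex on the cycle
  obtain ⟨m0, u0, hm0⟩ : ∃ m u, (f m).1 = Qv r u u 0 := by
    obtain ⟨u, v, i, h, hi, e0, e1⟩ := hf.adj 0
    have := cyc_sub_run hf h e0 e1 (r - i) (by omega)
    rw [show i + (r - i) = r by omega, Qv_top _ _ v] at this
    exact ⟨_, v, this⟩
  have step : ∀ m u, (f m).1 = Qv r u u 0 → ∃ v, G.Adj u v ∧
      ∀ j ≤ r, (f (m + j)).1 = Qv r u v j := by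
    intro m u hm
    obtain ⟨a, b, i, h, hi, e0, e1⟩ := hf.adj m
    obtain ⟨rfl, rfl⟩ := Qv_vert h.ne hi (e0.symm.trans hm)
    refine ⟨b, h, fun j hj => ?_⟩
    have := cyc_sub_run hf h e0 e1 j (by omega)
    simpa using this
  have all : ∀ k, ∃ u, (f (m0 + k * r)).1 = Qv r u u 0 := by
    intro k
    induction k with
    | zero => exact ⟨u0, by simpa using hm0⟩
    | succ k ih =>
      obtain ⟨u, hu⟩ := ih
      obtain ⟨v, -, hv⟩ := step _ u hu
      refine ⟨v, ?_⟩
      have := hv r le_rfl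
      rw [Qv_top _ _ v] at this
      rw [← this]; congr 2; ring
  choose g hg using all
  have gstep : ∀ k, G.Adj (g k) (g (k + 1)) ∧
      ∀ j ≤ r, (f (m0 + k * r + j)).1 = Qv r (g k) (g (k + 1)) j := by
    intro k
    obtain ⟨v, h, hv⟩ := step _ _ (hg k)
    have : v = g (k + 1) := by
      have e := hv r le_rfl
      rw [Qv_top _ _ v, show m0 + k * r + r = m0 + (k + 1) * r by ring, hg (k + 1)] at e
      exact (Qv_vert_inj hr e).symm
    subst this
    exact ⟨h, hv⟩
  have hdvd : L % r = 0 := by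
    have hlt : L % r < r := Nat.mod_lt _ hr
    have e := (gstep (L / r)).2 (L % r) hlt.le
    have e2 : f (m0 + L / r * r + L % r) = f m0 := by
      rw [hf.inj, add_assoc, Nat.div_add_mod']
      simp [Nat.ModEq]
    rw [e2, hm0] at e
    exact (Qv_vert (gstep _).1.ne hlt e.symm).1
  obtain ⟨l, rfl⟩ := Nat.dvd_of_mod_eq_zero hdvd
  have ginj : ∀ i j, g i = g j ↔ i ≡ j [MOD l] := by
    intro i j
    have : g i = g j ↔ f (m0 + i * r) = f (m0 + j * r) := by
      constructor
      · intro e; apply Subtype.ext; rw [hg, hg, e]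
      · intro e
        have := congrArg Subtype.val e
        rw [hg, hg] at this
        exact Qv_vert_inj hr this
    rw [this, hf.inj]
    constructor
    · intro h
      have := Nat.ModEq.add_left_cancel' m0 h
      rw [mul_comm i, mul_comm j] at this
      exact Nat.ModEq.mul_left_cancel' (by omega) this
    · intro h
      rw [mul_comm i, mul_comm j]
      exact (h.mul_left' r).add_left m0
  refine ⟨l, mem_cycLens.2 ⟨g, ?_, fun i => (gstep i).1, ginj⟩, rfl⟩
  by_contra hlt
  have : l = 0 ∨ l = 1 ∨ l = 2 := by omega
  rcases this with rfl | rfl | rfl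
  · omega
  · exact (gstep 0).1.ne ((ginj _ _).2 (by simp [Nat.modEq_one]))
  · have e2 : g 2 = g 0 := (ginj _ _).2 (by decide)
    have a := (gstep 0).2 (r - 1) (by omega)
    have b := (gstep 1).2 1 hr
    rw [e2, Qv_flip hr] at b
    apply hf.nb (m0 + 0 * r + (r - 1))
    apply Subtype.ext
    rw [a, show m0 + 0 * r + (r - 1) + 2 = m0 + 1 * r + 1 by omega, b]

theorem cycLens_sub (hr : 1 ≤ r) : cycLens (subG G r) = (fun x => r * x) '' cycLens G := by
  ext L
  constructor
  · intro h
    obtain ⟨l, hl, rfl⟩ := cyc_sub_bwd hr h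
    exact ⟨l, hl, rfl⟩
  · rintro ⟨l, hl, rfl⟩
    exact cyc_sub_fwd hr hl

theorem sub_reach {u v : V} (h : G.Adj u v) (i : ℕ) (hi : i ≤ r) :
    (subG G r).Reachable (ov G r u) (sqv r u v h i hi) := by
  induction i with
  | zero =>
    have : ov G r u = sqv r u v h 0 hi := Subtype.ext (Qv_zero _ _ _)
    rw [this]
  | succ i ih => exact (ih (by omega)).trans (sub_adj h (by omega)).reachable

theorem sub_connected (hG : G.Connected) : (subG G r).Connected := by
  have key : ∀ {u v : V} (p : G.Walk u v), (subG G r).Reachable (ov G r u) (ov G r v) := by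
    intro u v p
    induction p with
    | nil => exact SimpleGraph.Reachable.refl _
    | @cons u w v h p ih =>
      refine SimpleGraph.Reachable.trans ?_ ih
      have := sub_reach (r := r) h r le_rfl
      have e : sqv r u w h r le_rfl = ov G r w := Subtype.ext (Qv_top _ _ _)
      rwa [e] at this
  have top : ∀ x : SubV G r, ∃ u, (subG G r).Reachable (ov G r u) x := by
    rintro ⟨f, u, v, i, rfl | h, hi, rfl⟩
    · refine ⟨u, ?_⟩
      have : Qv r u u i = Qv r u u 0 := by
        funext x; simp only [Qv]; split_ifs <;> omega
      have e : (⟨Qv r u u i, u, u, i, Or.inl rfl, hi, rfl⟩ : SubV G r) = ov G r u :=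
        Subtype.ext this
      rw [e]
    · exact ⟨u, sub_reach h i hi⟩
  haveI := hG.nonempty
  haveI : Nonempty (SubV G r) := ⟨ov G r (Classical.arbitrary V)⟩
  refine ⟨fun x y => ?_⟩
  obtain ⟨u, hu⟩ := top x
  obtain ⟨v, hv⟩ := top y
  obtain ⟨p⟩ := hG.preconnected u v
  exact hu.symm.trans ((key p).trans hv)

end subdivision

section homs

variable {V W : Type} [Fintype V] [DecidableEq V] [Fintype W] [DecidableEq W]
  {G : SimpleGraph V} {H : SimpleGraph W}

/-- The map on metric graphs induced by a graph homomorphism. -/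
def homMap (e : V → W) (he : ∀ u v, G.Adj u v → H.Adj (e u) (e v)) (x : MGPoint G) : MGPoint H :=
  ⟨(e x.1.1, e x.1.2.1, x.1.2.2), he _ _ x.2.1, x.2.2⟩

theorem mgDist_vert {u v w : V} {h : G.Adj u v} {k : G.Adj u w} :
    mgDist G (mpt u v h 0 zero_mem_I) (mpt u w k 0 zero_mem_I) ≤ 0 := by
  refine mgDist_le_F.1.trans ?_
  simp

theorem homMap_le (hG : G.Connected) (hH : H.Connected) (e : V → W)
    (he : ∀ u v, G.Adj u v → H.Adj (e u) (e v)) (x y : MGPoint G) :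
    mgDist H (homMap e he x) (homMap e he y) ≤ mgDist G x y := by
  have := universal hG (C := 1) ((mgDist_isPM hH).comap (homMap e he)) ⟨?_, ?_, ?_⟩ x y
  · simpa using this
  · intro u v h s hs t ht
    rw [one_mul]
    exact mgDist_le_E (h := he _ _ h) (ht := hs) (h' := he _ _ h) (ht' := ht)
  · intro u v h t ht
    exact mgDist_flip (h := he _ _ h) (ht := ht) (h' := he _ _ h.symm) (ht' := sub_mem_I ht)
  · intro u v w h k
    exact mgDist_vert (h := he _ _ h) (k := he _ _ k)

theorem iso_facts (hG : G.Connected) (e : V ≃ W) (he : ∀ u v, G.Adj u v ↔ H.Adj (e u) (e v)) :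
    H.Connected ∧ cycLens H = cycLens G ∧ hypDelta H = hypDelta G := by
  have he' : ∀ u v, H.Adj u v → G.Adj (e.symm u) (e.symm v) := by
    intro u v h
    rw [he]; simpa using h
  have hH : H.Connected := (SimpleGraph.Iso.connected_iff (⟨e, (he _ _).symm⟩ : G ≃g H)).1 hG
  refine ⟨hH, ?_, ?_⟩
  · exact Set.Subset.antisymm (cyc_map e.symm e.symm.injective he')
      (cyc_map e e.injective fun u v => (he u v).1)
  · have c1 : ∀ x : MGPoint G, homMap e.symm he' (homMap e (fun u v => (he u v).1) x) = x := by
      intro x; apply Subtype.ext; simp [homMap]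
    have c2 : ∀ x : MGPoint H, homMap e (fun u v => (he u v).1) (homMap e.symm he' x) = x := by
      intro x; apply Subtype.ext; simp [homMap]
    apply le_antisymm
    · have := sim_le hG (f := homMap e.symm he') (r := 1) one_pos ?_
      · simpa using this
      · intro x y
        rw [one_mul]
        refine le_antisymm (homMap_le hH hG _ _ _ _) ?_
        have := homMap_le hG hH e (fun u v => (he u v).1) (homMap e.symm he' x)
          (homMap e.symm he' y)
        rwa [c2, c2] at this
    · have := sim_le hH (f := homMap e (fun u v => (he u v).1)) (r := 1) one_pos ?_
      · simpa using this
      · intro x y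
        rw [one_mul]
        refine le_antisymm (homMap_le hG hH _ _ _ _) ?_
        have := homMap_le hH hG e.symm he' (homMap e (fun u v => (he u v).1) x)
          (homMap e (fun u v => (he u v).1) y)
        rwa [c1, c1] at this

/-- Transport to `Fin N`. -/
theorem exists_fin (hG : G.Connected) {N : ℕ} (hN : Fintype.card V = N) :
    ∃ H : SimpleGraph (Fin N), H.Connected ∧ cycLens H = cycLens G ∧ hypDelta H = hypDelta G := by
  let e := Fintype.equivFinOfCardEq hN
  refine ⟨G.comap e.symm, iso_facts hG e ?_⟩
  intro u v
  simp [SimpleGraph.comap_adj]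

end homs

section pendant

variable {V : Type} [Fintype V] [DecidableEq V] {G : SimpleGraph V}

/-- Adjacency in the graph with one pendant vertex added at `w`. -/
def pendAdj (G : SimpleGraph V) (w : V) : Option V → Option V → Prop
  | some u, some v => G.Adj u v
  | some u, none => u = w
  | none, some v => v = w
  | none, none => False

/-- The graph with one pendant vertex added at `w`. -/
def pend (G : SimpleGraph V) (w : V) : SimpleGraph (Option V) where
  Adj := pendAdj G w
  symm := ⟨by
    rintro (_ | u) (_ | v) h
    · exact h
    · exact h
    · exact h
    · exact (SimpleGraph.Adj.symm (G := G) h)⟩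
  loopless := ⟨by
    rintro (_ | u) h
    · exact h
    · exact G.loopless.irrefl u h⟩

/-- Collapsing the pendant edge. -/
def pρ {w w0 : V} (hw : G.Adj w w0) : MGPoint (pend G w) → MGPoint G
  | ⟨(some u, some v, t), h⟩ => mpt u v h.1 t h.2
  | ⟨(some _, none, _), _⟩ => mpt w w0 hw 0 zero_mem_I
  | ⟨(none, some _, _), _⟩ => mpt w w0 hw 0 zero_mem_I
  | ⟨(none, none, _), _⟩ => mpt w w0 hw 0 zero_mem_I

/-- Height on the pendant edge. -/
def pht {w : V} : MGPoint (pend G w) → ℝ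
  | ⟨(some _, some _, _), _⟩ => 0
  | ⟨(some _, none, t), _⟩ => t
  | ⟨(none, some _, t), _⟩ => 1 - t
  | ⟨(none, none, _), _⟩ => 0

theorem pend_some {w : V} (u v : V) (h : G.Adj u v) : (pend G w).Adj (some u) (some v) := h

theorem pend_edge (w : V) : (pend G w).Adj (some w) none := rfl

theorem pend_connected (hG : G.Connected) (w : V) : (pend G w).Connected := by
  have key : ∀ u, (pend G w).Reachable (some w) (some u) := by
    intro u
    obtain ⟨p⟩ := hG.preconnected w u
    exact ⟨p.map (⟨some, fun {a b} h => h⟩ : G →g pend G w)⟩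
  have key' : ∀ x, (pend G w).Reachable (some w) x := by
    rintro (_ | u)
    · exact (pend_edge w).reachable
    · exact key u
  have : Nonempty (Option V) := ⟨none⟩
  exact ⟨fun x y => (key' x).symm.trans (key' y)⟩

theorem pend_cycLens (w : V) : cycLens (pend G w) = cycLens G := by
  apply Set.Subset.antisymm
  · intro l hl
    obtain ⟨f, hf⟩ := mem_cycLens.1 hl
    have h3 := hf.three
    have hs : ∀ i, ∃ u, f i = some u := by
      intro i
      by_contra hc
      have hn : f i = none := by
        rcases h : f i with _ | u
        · rfl
        · exact absurd ⟨u, h⟩ hc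
      have e : f (i + l) = none := by
        rw [← hn, hf.inj]; simp [Nat.ModEq]
      have a := hf.adj (i + l)
      have b := hf.adj (i + l - 1)
      rw [show i + l - 1 + 1 = i + l by omega, e] at b
      rw [e] at a
      have hw1 : f (i + l + 1) = some w := by
        rcases h : f (i + l + 1) with _ | u
        · rw [h] at a; exact a.elim
        · rw [h] at a; exact congrArg some a
      have hw2 : f (i + l - 1) = some w := by
        rcases h : f (i + l - 1) with _ | u
        · rw [h] at b; exact b.elim
        · rw [h] at b; exact congrArg some b
      apply hf.nb (i + l - 1)
      rw [hw2, show i + l - 1 + 2 = i + l + 1 by omega, hw1]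
    choose g hg using hs
    refine mem_cycLens.2 ⟨g, h3, fun i => ?_, fun i j => ?_⟩
    · have := hf.adj i
      rw [hg, hg] at this
      exact this
    · rw [← hf.inj, hg, hg, Option.some_inj]
  · exact cyc_map some (Option.some_injective _) fun u v h => h

/-- The metric on the graph with the pendant edge, as computed below. -/
noncomputable def pD {w w0 : V} (hw : G.Adj w w0) (x y : MGPoint (pend G w)) : ℝ :=
  mgDist G (pρ hw x) (pρ hw y) + |pht x - pht y|

theorem pD_isPM (hG : G.Connected) {w w0 : V} (hw : G.Adj w w0) : IsPM (pD hw) where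
  refl x := by simp [pD, (mgDist_isPM hG).refl]
  symm x y := by rw [pD, pD, (mgDist_isPM hG).symm, abs_sub_comm]
  tri x y z := by
    have h1 := (mgDist_isPM hG).tri (pρ hw x) (pρ hw y) (pρ hw z)
    have h2 := abs_sub_le (pht x) (pht y) (pht z)
    simp only [pD]; linarith

theorem pD_lip (hG : G.Connected) {w w0 : V} (hw : G.Adj w w0) :
    LocalLip (pend G w) 1 (pD hw) where
  edge := by
    have R := (mgDist_isPM hG).refl (mpt w w0 hw 0 zero_mem_I)
    rintro (_ | u) (_ | v) h s hs t ht
    · exact h.elim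
    · rw [one_mul]
      change mgDist G (mpt w w0 hw 0 zero_mem_I) (mpt w w0 hw 0 zero_mem_I) +
        |(1 - s) - (1 - t)| ≤ _
      rw [R, zero_add, show (1 - s) - (1 - t) = t - s by ring, abs_sub_comm]
    · rw [one_mul]
      change mgDist G (mpt w w0 hw 0 zero_mem_I) (mpt w w0 hw 0 zero_mem_I) + |s - t| ≤ _
      rw [R, zero_add]
    · rw [one_mul]
      change mgDist G (mpt u v h s hs) (mpt u v h t ht) + |(0:ℝ) - 0| ≤ _
      have := @mgDist_le_E V _ _ G u v h s hs h t ht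
      simpa using this
  flip := by
    have R := (mgDist_isPM hG).refl (mpt w w0 hw 0 zero_mem_I)
    rintro (_ | u) (_ | v) h t ht
    · exact h.elim
    · change mgDist G (mpt w w0 hw 0 zero_mem_I) (mpt w w0 hw 0 zero_mem_I) +
        |(1 - t) - (1 - t)| ≤ _
      rw [R]; simp
    · change mgDist G (mpt w w0 hw 0 zero_mem_I) (mpt w w0 hw 0 zero_mem_I) +
        |t - (1 - (1 - t))| ≤ _
      rw [R]; simp
    · change mgDist G (mpt u v h t ht) (mpt v u ((SimpleGraph.Adj.symm (G := G) h)) (1 - t) (sub_mem_I ht)) +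
        |(0:ℝ) - 0| ≤ _
      have := @mgDist_flip V _ _ G u v h t ht ((SimpleGraph.Adj.symm (G := G) h)) (sub_mem_I ht)
      simpa using this
  vert := by
    have R := (mgDist_isPM hG).refl (mpt w w0 hw 0 zero_mem_I)
    rintro (_ | u) (_ | v) (_ | z) h k
    · exact h.elim
    · exact h.elim
    · exact k.elim
    · change mgDist G (mpt w w0 hw 0 zero_mem_I) (mpt w w0 hw 0 zero_mem_I) +
        |((1:ℝ) - 0) - (1 - 0)| ≤ _
      rw [R]; simp
    · change mgDist G (mpt w w0 hw 0 zero_mem_I) (mpt w w0 hw 0 zero_mem_I) +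
        |(0:ℝ) - 0| ≤ _
      rw [R]; simp
    · change mgDist G (mpt w w0 hw 0 zero_mem_I) (mpt u z k 0 zero_mem_I) + |(0:ℝ) - 0| ≤ _
      obtain rfl : u = w := h
      have := @mgDist_vert V _ _ G u w0 z hw k
      simpa using this
    · change mgDist G (mpt u v h 0 zero_mem_I) (mpt w w0 hw 0 zero_mem_I) + |(0:ℝ) - 0| ≤ _
      obtain rfl : u = w := k
      have := @mgDist_vert V _ _ G u v w0 h hw
      simpa using this
    · change mgDist G (mpt u v h 0 zero_mem_I) (mpt u z k 0 zero_mem_I) + |(0:ℝ) - 0| ≤ _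
      have := @mgDist_vert V _ _ G u v z h k
      simpa using this

theorem p_cases (hG : G.Connected) {w w0 : V} (hw : G.Adj w w0) (x : MGPoint (pend G w)) :
    (pht x = 0 ∧ homMap some pend_some (pρ hw x) = x) ∨
    (∃ t ht, pht x = t ∧ pρ hw x = mpt w w0 hw 0 zero_mem_I ∧
      mgDist (pend G w) x (mpt (some w) none (pend_edge w) t ht) ≤ 0) := by
  have PM := mgDist_isPM (pend_connected hG w)
  obtain ⟨a, b, h, t, ht, rfl⟩ := exists_mpt x
  rcases a with _ | u <;> rcases b with _ | v
  · exact h.elim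
  · right
    obtain rfl : v = w := h
    exact ⟨1 - t, sub_mem_I ht, rfl, rfl, mgDist_flip⟩
  · right
    obtain rfl : u = w := h
    exact ⟨t, ht, rfl, rfl, (PM.refl _).le⟩
  · left
    exact ⟨rfl, rfl⟩

theorem pend_hair (hG : G.Connected) {w w0 : V} (hw : G.Adj w w0) :
    Hair G (pend G w) (pρ hw) pht (mpt w w0 hw 0 zero_mem_I) := by
  have hG' := pend_connected hG w
  have PM := mgDist_isPM hG'
  have PM0 := mgDist_isPM hG
  have nn : ∀ x : MGPoint (pend G w), 0 ≤ pht x := by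
    intro x
    rcases p_cases hG hw x with ⟨h, -⟩ | ⟨t, ht, h, -⟩
    · exact h.ge
    · rw [h]; exact ht.1
  refine ⟨fun x y => le_antisymm ?_ ?_, nn, ?_⟩
  · have key : ∀ x, mgDist (pend G w) x (homMap some pend_some (pρ hw x)) ≤ pht x := by
      intro x
      rcases p_cases hG hw x with ⟨h, e⟩ | ⟨t, ht, h, e, e'⟩
      · rw [h, e, PM.refl]
      · rw [PM.congr_zero e' (PM.refl _).le, e, h]
        refine (mgDist_le_F (h' := pend_some w w0 hw) (ht' := zero_mem_I)).1.trans ?_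
        simp
    have hx := key x
    have hy := key y
    rw [PM.symm] at hy
    have hh := homMap_le hG hG' some pend_some (pρ hw x) (pρ hw y)
    have t1 := PM.tri x (homMap some pend_some (pρ hw x)) y
    have t2 := PM.tri (homMap some pend_some (pρ hw x)) (homMap some pend_some (pρ hw y)) y
    have i1 := le_abs_self (pht x - pht y)
    have i2 := neg_abs_le (pht x - pht y)
    rcases p_cases hG hw x with ⟨h, e⟩ | ⟨t, ht, h, e, e'⟩
    · linarith
    · rcases p_cases hG hw y with ⟨k, f⟩ | ⟨s, hs, k, f, f'⟩
      · linarith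
      · rw [PM.congr_zero e' f', e, f, h, k, PM0.refl, zero_add]
        exact mgDist_le_E
  · have := universal hG' (pD_isPM hG hw) (pD_lip hG hw) x y
    rw [one_mul] at this
    exact this
  · intro x
    rcases p_cases hG hw x with ⟨h, e⟩ | ⟨t, ht, h, e, e'⟩
    · exact Or.inl h
    · right; rw [e]; exact PM0.refl _

theorem pend_hyp (hG : G.Connected) {w w0 : V} (hw : G.Adj w w0) :
    hypDelta (pend G w) = hypDelta G := by
  have H := pend_hair hG hw
  apply le_antisymm (hair_le hG H)
  have := sim_le (pend_connected hG w) (G := G) (f := homMap some pend_some) (r := 1) one_pos ?_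
  · simpa using this
  · intro x y
    rw [H.dist_eq, one_mul]
    obtain ⟨u, v, h, t, ht, rfl⟩ := exists_mpt x
    obtain ⟨u', v', h', t', ht', rfl⟩ := exists_mpt y
    change mgDist G (mpt u v h t ht) (mpt u' v' h' t' ht') + |(0:ℝ) - 0| = _
    simp

/-- Padding with pendant vertices. -/
theorem pad (hG : G.Connected) (hV : 2 ≤ Fintype.card V) {N : ℕ} (hN : Fintype.card V ≤ N) :
    ∃ H : SimpleGraph (Fin N), H.Connected ∧ cycLens H = cycLens G ∧ hypDelta H = hypDelta G := by
  induction N, hN using Nat.le_induction with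
  | base => exact exists_fin hG rfl
  | succ N hN ih =>
    obtain ⟨H, h1, h2, h3⟩ := ih
    let w : Fin N := ⟨0, by omega⟩
    have : Nontrivial (Fin N) := ⟨⟨0, by omega⟩, ⟨1, by omega⟩, by simp⟩
    obtain ⟨w0, hw⟩ := h1.preconnected.exists_adj_of_nontrivial w
    obtain ⟨K, k1, k2, k3⟩ := exists_fin (pend_connected h1 w) (N := N + 1) (by simp)
    exact ⟨K, k1, by rw [k2, pend_cycLens, h2], by rw [k3, pend_hyp h1 hw, h3]⟩

end pendant

section submetric

variable {V : Type} [Fintype V] [DecidableEq V] {G : SimpleGraph V} {r : ℕ}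

theorem sub_surj (hr : 1 ≤ r) : ∃ f : V ⊕ (G.edgeSet × Fin (r - 1)) → SubV G r,
    Function.Surjective f := by
  have key : ∀ e : G.edgeSet, ∃ u v, G.Adj u v ∧ e.1 = s(u, v) := by
    rintro ⟨e, he⟩
    induction e using Sym2.ind with
    | _ u v => exact ⟨u, v, he, rfl⟩
  choose a b hab he using key
  refine ⟨Sum.elim (fun u => ov G r u)
    (fun p => sqv r (a p.1) (b p.1) (hab p.1) (p.2.1 + 1) (by have := p.2.2; omega)), ?_⟩
  rintro ⟨f, u, v, i, h, hi, rfl⟩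
  rcases h with rfl | h
  · refine ⟨Sum.inl u, Subtype.ext ?_⟩
    change Qv r u u 0 = Qv r u u i
    funext x; simp only [Qv]; split_ifs <;> omega
  · rcases Nat.eq_zero_or_pos i with rfl | h0
    · exact ⟨Sum.inl u, Subtype.ext (Qv_zero _ _ _)⟩
    · rcases Nat.lt_or_ge i r with h1 | h1
      · let e : G.edgeSet := ⟨s(u, v), h⟩
        have := he e
        rw [Sym2.eq_iff] at this
        rcases this with ⟨e1, e2⟩ | ⟨e1, e2⟩
        · refine ⟨Sum.inr (e, ⟨i - 1, by omega⟩), Subtype.ext ?_⟩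
          change Qv r (a e) (b e) (i - 1 + 1) = _
          rw [← e1, ← e2, show i - 1 + 1 = i by omega]
        · refine ⟨Sum.inr (e, ⟨r - i - 1, by omega⟩), Subtype.ext ?_⟩
          change Qv r (a e) (b e) (r - i - 1 + 1) = _
          rw [← e1, ← e2, show r - i - 1 + 1 = r - i by omega, ← Qv_flip hi]
      · obtain rfl : i = r := by omega
        exact ⟨Sum.inl v, Subtype.ext (Qv_top _ _ _).symm⟩

theorem sub_finite (hr : 1 ≤ r) : Finite (SubV G r) := by
  obtain ⟨f, hf⟩ := sub_surj (G := G) hr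
  exact Finite.of_surjective f hf

theorem sub_card (hr : 1 ≤ r) [Fintype (SubV G r)] :
    Fintype.card (SubV G r) ≤ Fintype.card V + (r - 1) * G.edgeSet.ncard := by
  obtain ⟨f, hf⟩ := sub_surj (G := G) hr
  have := Nat.card_le_card_of_surjective f hf
  rw [Nat.card_eq_fintype_card, Nat.card_sum, Nat.card_prod, Nat.card_eq_fintype_card,
    Nat.card_eq_fintype_card (α := Fin (r - 1)), Fintype.card_fin, Nat.card_coe_set_eq,
    mul_comm] at this
  exact this

theorem sub_card_ge (hr : 1 ≤ r) [Fintype (SubV G r)] :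
    Fintype.card V ≤ Fintype.card (SubV G r) := by
  refine Fintype.card_le_of_injective (ov G r) ?_
  intro u v e
  exact Qv_vert_inj hr (congrArg Subtype.val e)

/-- Barycentric coordinates of a point. -/
def bary (x : MGPoint G) : V → ℝ :=
  fun z => (if z = x.1.1 then 1 - x.1.2.2 else 0) + (if z = x.1.2.1 then x.1.2.2 else 0)

theorem bary_mpt {u v : V} {h : G.Adj u v} {t : ℝ} {ht : t ∈ Set.Icc (0:ℝ) 1} (z : V) :
    bary (mpt u v h t ht) z = (if z = u then 1 - t else 0) + (if z = v then t else 0) := rfl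

theorem bary_eq {x y : MGPoint G} (e : bary x = bary y) : mgDist G x y ≤ 0 := by
  obtain ⟨u, v, h, t, ht, rfl⟩ := exists_mpt x
  obtain ⟨a, b, k, s, hs, rfl⟩ := exists_mpt y
  have hu := congrFun e u
  have hv := congrFun e v
  have ha := congrFun e a
  have hb := congrFun e b
  have n1 := h.ne
  have n2 := h.ne'
  have n3 := k.ne
  have n4 := k.ne'
  simp only [bary_mpt, if_true, if_neg n1, if_neg n2, if_neg n3, if_neg n4, add_zero,
    zero_add] at hu hv ha hb
  obtain ⟨F1, F2, F3, F4⟩ := @mgDist_le_F V _ _ G u v h t ht a b k s hs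
  by_cases c1 : u = a
  · subst c1
    by_cases c2 : v = b
    · subst c2
      simp [n2] at hv
      refine mgDist_le_E.trans ?_
      simp [hv]
    · simp [n2, c2] at hv
      simp [n4, Ne.symm c2] at hb
      refine F1.trans ?_
      simp [hv, hb.symm]
  · by_cases c2 : u = b
    · subst c2
      by_cases c3 : v = a
      · subst c3
        simp [n2] at hv
        refine mgDist_le_E'.trans ?_
        simp [hv]
      · simp [n2, c3] at hv
        simp [n3, Ne.symm c3] at ha
        refine F2.trans ?_
        simp [hv, ha.symm]
    · simp [c1, c2, n1] at hu
      by_cases c3 : v = a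
      · subst c3
        simp [n3] at hv
        refine F3.trans ?_
        simp
        linarith
      · by_cases c4 : v = b
        · subst c4
          simp [n4] at hv
          refine F4.trans ?_
          simp
          linarith
        · simp [c3, c4] at hv
          linarith

/-- Barycentric coordinates, with respect to `G`, of a point of the subdivision. -/
noncomputable def sbary (x : MGPoint (subG G r)) : V → ℝ :=
  fun z => ((1 - x.1.2.2) * (x.1.1.1 z : ℝ) + x.1.2.2 * (x.1.2.1.1 z : ℝ)) / r

/-- A point on the `i`-th segment of the edge `[u,v]`. -/
def seg {u v : V} (h : G.Adj u v) (i : ℕ) (hi : i < r) (t : ℝ) (ht : t ∈ Set.Icc (0:ℝ) 1) :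
    MGPoint (subG G r) :=
  mpt (sqv r u v h i hi.le) (sqv r u v h (i + 1) hi) (sub_adj h hi) t ht

theorem exists_seg {a b : SubV G r} (k : (subG G r).Adj a b) :
    ∃ u v, ∃ h : G.Adj u v, ∃ i, ∃ hi : i < r, ∀ t ht, mpt a b k t ht = seg h i hi t ht := by
  obtain ⟨a, ha⟩ := a
  obtain ⟨b, hb⟩ := b
  obtain ⟨u, v, i, h, hi, ea, eb⟩ := id k
  simp only at ea eb
  subst ea eb
  exact ⟨u, v, h, i, hi, fun t ht => rfl⟩

theorem frac_mem {i : ℕ} (hi : i < r) {t : ℝ} (ht : t ∈ Set.Icc (0:ℝ) 1) :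
    (i + t) / r ∈ Set.Icc (0:ℝ) 1 := by
  have h0 : (0:ℝ) < r := by exact_mod_cast (by omega : 0 < r)
  have h1 : (i:ℝ) + 1 ≤ r := by exact_mod_cast hi
  constructor
  · have := ht.1; positivity
  · rw [div_le_one h0]; linarith [ht.2]

theorem sbary_seg {u v : V} (h : G.Adj u v) (i : ℕ) (hi : i < r) (t : ℝ)
    (ht : t ∈ Set.Icc (0:ℝ) 1) :
    sbary (seg h i hi t ht) = bary (mpt u v h ((i + t) / r) (frac_mem hi ht)) := by
  have h0 : (r:ℝ) ≠ 0 := by exact_mod_cast (by omega : r ≠ 0)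
  funext z
  rw [bary_mpt]
  simp only [sbary, seg, mpt, sqv, Qv]
  have c1 : ((r - i : ℕ) : ℝ) = r - i := by rw [Nat.cast_sub hi.le]
  have c2 : ((r - (i + 1) : ℕ) : ℝ) = r - (i + 1) := by rw [Nat.cast_sub hi]; simp
  by_cases e1 : z = u <;> by_cases e2 : z = v
  · exact absurd (e1.symm.trans e2) h.ne
  · simp only [if_pos e1, if_neg e2, add_zero, c1, c2]
    field_simp; ring
  · simp only [if_neg e1, if_pos e2, zero_add]
    push_cast
    field_simp; ring
  · simp [e1, e2]

theorem exists_rho (x : MGPoint (subG G r)) : ∃ y : MGPoint G, bary y = sbary x := by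
  obtain ⟨a, b, k, t, ht, rfl⟩ := exists_mpt x
  obtain ⟨u, v, h, i, hi, e⟩ := exists_seg k
  exact ⟨_, by rw [e, sbary_seg]⟩

/-- The map from the subdivision to the graph. -/
noncomputable def rho (x : MGPoint (subG G r)) : MGPoint G := (exists_rho x).choose

theorem rho_spec (x : MGPoint (subG G r)) : bary (rho x) = sbary x := (exists_rho x).choose_spec

theorem rho_seg {u v : V} (h : G.Adj u v) (i : ℕ) (hi : i < r) (t : ℝ)
    (ht : t ∈ Set.Icc (0:ℝ) 1) :
    mgDist G (rho (seg h i hi t ht)) (mpt u v h ((i + t) / r) (frac_mem hi ht)) ≤ 0 :=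
  bary_eq (by rw [rho_spec, sbary_seg])

theorem rho_lip (hG : G.Connected) [Fintype (SubV G r)] [DecidableEq (SubV G r)] :
    LocalLip (subG G r) (1 / r) (fun x y => mgDist G (rho x) (rho y)) where
  edge a b k s hs t ht := by
    obtain ⟨u, v, h, i, hi, e⟩ := exists_seg k
    have h0 : (0:ℝ) < r := by exact_mod_cast (by omega : 0 < r)
    simp only [e]
    rw [(mgDist_isPM hG).congr_zero (rho_seg h i hi s hs) (rho_seg h i hi t ht)]
    refine mgDist_le_E.trans (le_of_eq ?_)
    rw [← sub_div, abs_div, abs_of_pos h0, show (i:ℝ) + s - (i + t) = s - t by ring]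
    ring
  flip a b k t ht := by
    refine bary_eq ?_
    rw [rho_spec, rho_spec]
    funext z
    simp only [sbary, mpt]; ring
  vert a b c k l := by
    refine bary_eq ?_
    rw [rho_spec, rho_spec]
    funext z
    simp only [sbary, mpt]; ring

section fin
variable [Fintype (SubV G r)] [DecidableEq (SubV G r)]

theorem sqv_dist (hG : G.Connected) {u v : V} (h : G.Adj u v) {i j : ℕ} (hij : i ≤ j)
    (hj : j ≤ r) : (subG G r).dist (sqv r u v h i (hij.trans hj)) (sqv r u v h j hj) ≤ j - i := by
  induction j, hij using Nat.le_induction with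
  | base => simp
  | succ j hij ih =>
    have h1 := ih (by omega)
    have h2 := (sub_connected (r := r) hG).dist_triangle (u := sqv r u v h i (by omega))
      (v := sqv r u v h j (by omega)) (w := sqv r u v h (j + 1) hj)
    have h3 := SimpleGraph.dist_eq_one_iff_adj.2 (sub_adj (r := r) h (i := j) hj)
    omega

theorem seg_le_aux (hG : G.Connected) {u v : V} (h : G.Adj u v) {i j : ℕ} (hi : i < r)
    (hj : j < r) {s t : ℝ} (hs : s ∈ Set.Icc (0:ℝ) 1) (ht : t ∈ Set.Icc (0:ℝ) 1) (hij : i ≤ j) :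
    mgDist (subG G r) (seg h i hi s hs) (seg h j hj t ht) ≤ |(i + s) - (j + t)| := by
  rcases hij.eq_or_lt with rfl | hlt
  · refine mgDist_le_E.trans (le_of_eq ?_)
    congr 1; ring
  · refine mgDist_le_F.2.2.1.trans ?_
    have h1 := sqv_dist (r := r) hG h (i := i + 1) (j := j) hlt hj.le
    have h2 : ((subG G r).dist (sqv r u v h (i + 1) hi) (sqv r u v h j hj.le) : ℝ) + (i + 1) ≤ j := by
      exact_mod_cast (by omega :
        (subG G r).dist (sqv r u v h (i + 1) hi) (sqv r u v h j hj.le) + (i + 1) ≤ j)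
    have := neg_abs_le ((i + s) - (j + t))
    linarith

theorem seg_le (hG : G.Connected) {u v : V} (h : G.Adj u v) {i j : ℕ} (hi : i < r)
    (hj : j < r) {s t : ℝ} (hs : s ∈ Set.Icc (0:ℝ) 1) (ht : t ∈ Set.Icc (0:ℝ) 1) :
    mgDist (subG G r) (seg h i hi s hs) (seg h j hj t ht) ≤ |(i + s) - (j + t)| := by
  rcases le_total i j with hij | hij
  · exact seg_le_aux hG h hi hj hs ht hij
  · rw [(mgDist_isPM (sub_connected hG)).symm, abs_sub_comm]
    exact seg_le_aux hG h hj hi ht hs hij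

theorem phi_exists (hr : 1 ≤ r) {t : ℝ} (ht : t ∈ Set.Icc (0:ℝ) 1) :
    ∃ i, i < r ∧ (r * t - i) ∈ Set.Icc (0:ℝ) 1 := by
  have h0 : (1:ℝ) ≤ r := by exact_mod_cast hr
  have hn : 0 ≤ r * t := mul_nonneg (by linarith) ht.1
  have hle : r * t ≤ r := by nlinarith [ht.2]
  rcases Nat.lt_or_ge ⌊(r * t : ℝ)⌋₊ r with h | h
  · refine ⟨_, h, ?_, ?_⟩
    · linarith [Nat.floor_le hn]
    · linarith [Nat.lt_floor_add_one (r * t : ℝ)]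
  · refine ⟨r - 1, by omega, ?_⟩
    have : (r:ℝ) ≤ r * t := (Nat.le_floor_iff hn).1 h
    have e : r * t = r := le_antisymm hle this
    rw [e, Nat.cast_sub hr]
    simp

/-- The map from the graph to the subdivision. -/
noncomputable def phi (hr : 1 ≤ r) (x : MGPoint G) : MGPoint (subG G r) :=
  seg x.2.1 (phi_exists hr x.2.2).choose (phi_exists hr x.2.2).choose_spec.1 _
    (phi_exists hr x.2.2).choose_spec.2

theorem phi_eq (hr : 1 ≤ r) {u v : V} (h : G.Adj u v) (t : ℝ) (ht : t ∈ Set.Icc (0:ℝ) 1) :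
    ∃ i, ∃ hi : i < r, ∃ hs : r * t - i ∈ Set.Icc (0:ℝ) 1,
      phi hr (mpt u v h t ht) = seg h i hi (r * t - i) hs :=
  ⟨_, _, _, rfl⟩

theorem phi_seg (hG : G.Connected) (hr : 1 ≤ r) {u v : V} (h : G.Adj u v) (t : ℝ)
    (ht : t ∈ Set.Icc (0:ℝ) 1) {i : ℕ} (hi : i < r) {s : ℝ} (hs : s ∈ Set.Icc (0:ℝ) 1)
    (e : r * t = i + s) : mgDist (subG G r) (phi hr (mpt u v h t ht)) (seg h i hi s hs) ≤ 0 := by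
  obtain ⟨j, hj, hs', e'⟩ := phi_eq hr h t ht
  rw [e']
  refine (seg_le hG h hj hi hs' hs).trans (le_of_eq ?_)
  rw [e]; simp

theorem seg_flip {u v : V} (h : G.Adj u v) {i : ℕ} (hi : i < r) {s : ℝ}
    (hs : s ∈ Set.Icc (0:ℝ) 1) :
    mgDist (subG G r) (seg h i hi s hs)
      (seg h.symm (r - 1 - i) (by omega) (1 - s) (sub_mem_I hs)) ≤ 0 := by
  have e1 : sqv r v u h.symm (r - 1 - i) (by omega) = sqv r u v h (i + 1) hi := by
    apply Subtype.ext
    simp only [sqv]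
    rw [Qv_flip (by omega)]; congr 1; omega
  have e2 : sqv r v u h.symm (r - 1 - i + 1) (by omega) = sqv r u v h i hi.le := by
    apply Subtype.ext
    simp only [sqv]
    rw [Qv_flip (by omega)]; congr 1; omega
  simp only [seg, e1, e2]
  exact mgDist_flip

theorem phi_lip (hG : G.Connected) (hr : 1 ≤ r) :
    LocalLip G r (fun x y => mgDist (subG G r) (phi hr x) (phi hr y)) where
  edge u v h s hs t ht := by
    have PM := mgDist_isPM (sub_connected (r := r) hG)
    have h0 : (0:ℝ) ≤ r := by positivity
    obtain ⟨i, hi, hi', e⟩ := phi_eq hr h s hs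
    obtain ⟨j, hj, hj', e'⟩ := phi_eq hr h t ht
    simp only [e, e']
    refine (seg_le hG h hi hj hi' hj').trans (le_of_eq ?_)
    rw [show (i:ℝ) + (r * s - i) - (j + (r * t - j)) = r * (s - t) by ring, abs_mul,
      abs_of_nonneg h0]
  flip u v h t ht := by
    have PM := mgDist_isPM (sub_connected (r := r) hG)
    obtain ⟨i, hi, hi', e⟩ := phi_eq hr h t ht
    have h1 := seg_flip h hi hi'
    have h2 := phi_seg hG hr h.symm (1 - t) (sub_mem_I ht) (i := r - 1 - i) (by omega)
      (sub_mem_I hi') (by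
        rw [Nat.cast_sub (by omega), Nat.cast_sub hr]; push_cast; ring)
    simp only [e]
    rw [PM.congr_zero h1 h2, PM.refl]
  vert u v w h k := by
    have PM := mgDist_isPM (sub_connected (r := r) hG)
    have h1 := phi_seg hG hr h 0 zero_mem_I (i := 0) hr zero_mem_I (by simp)
    have h2 := phi_seg hG hr k 0 zero_mem_I (i := 0) hr zero_mem_I (by simp)
    rw [PM.congr_zero h1 h2]
    refine mgDist_le_F.1.trans ?_
    have e : sqv r u v h 0 (Nat.zero_le _) = sqv r u w k 0 (Nat.zero_le _) :=
      Subtype.ext (Qv_zero _ _ _)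
    rw [e]; simp

theorem sub_hyp (hG : G.Connected) (hr : 1 ≤ r) : hypDelta (subG G r) = r * hypDelta G := by
  have hG' := sub_connected (r := r) hG
  have PM := mgDist_isPM hG
  have PM' := mgDist_isPM hG'
  have h0 : (0:ℝ) < r := by exact_mod_cast hr
  have L1 := universal hG (PM'.comap (phi hr)) (phi_lip hG hr)
  have L2 := universal hG' (PM.comap rho) (rho_lip (r := r) hG)
  have A : ∀ x : MGPoint G, mgDist G x (rho (phi hr x)) ≤ 0 := by
    intro x
    obtain ⟨u, v, h, t, ht, rfl⟩ := exists_mpt x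
    obtain ⟨i, hi, hi', e⟩ := phi_eq hr h t ht
    refine bary_eq ?_
    rw [rho_spec, e, sbary_seg]
    congr 1
    apply mpt_congr
    field_simp; ring
  have B : ∀ x : MGPoint (subG G r), mgDist (subG G r) x (phi hr (rho x)) ≤ 0 := by
    intro x
    obtain ⟨a, b, k, t, ht, rfl⟩ := exists_mpt x
    obtain ⟨u, v, h, i, hi, e⟩ := exists_seg k
    rw [e]
    have h1 := rho_seg h i hi t ht
    have h2 := L1 (rho (seg h i hi t ht)) (mpt u v h ((i + t) / r) (frac_mem hi ht))
    have h3 := phi_seg hG hr h ((i + t) / r) (frac_mem hi ht) hi ht (by field_simp)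
    have h4 : mgDist (subG G r) (phi hr (rho (seg h i hi t ht)))
        (phi hr (mpt u v h ((i + t) / r) (frac_mem hi ht))) ≤ 0 := by
      refine h2.trans ?_
      nlinarith
    rw [PM'.symm, PM'.congr_zero h4 (PM'.refl (seg h i hi t ht)).le]
    exact h3
  apply le_antisymm
  · have := sim_le hG (G := subG G r) (f := rho) (r := 1 / r) (by positivity) ?_
    · rw [one_div, inv_mul_le_iff₀ h0] at this
      exact this
    · intro x y
      refine le_antisymm (L2 x y) ?_
      rw [PM'.congr_zero (B x) (B y), one_div, inv_mul_le_iff₀ h0]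
      exact L1 _ _
  · refine sim_le hG' (f := phi hr) h0 ?_
    intro x y
    refine le_antisymm (L1 x y) ?_
    rw [PM.congr_zero (A x) (A y)]
    have := L2 (phi hr x) (phi hr y)
    rw [one_div, ← div_eq_inv_mul, le_div_iff₀ h0] at this
    rw [mul_comm]; exact this

end fin

end submetric

section final

theorem exists_scaled {g c n r N : ℕ} (h3 : 3 ≤ g) (hgc : g ≤ c) (hcn : c ≤ n) (hr : 1 ≤ r)
    (G : SimpleGraph (Fin n)) (hG : memGclass g c G)
    (hN : n + (r - 1) * G.edgeSet.ncard ≤ N) :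
    ∃ H : SimpleGraph (Fin N), memGclass (r * g) (r * c) H ∧ hypDelta H = r * hypDelta G := by
  obtain ⟨hc, hg, hcc⟩ := hG
  have := sub_finite (G := G) hr
  let _ : Fintype (SubV G r) := Fintype.ofFinite _
  let _ : DecidableEq (SubV G r) := Classical.decEq _
  have c1 := sub_card (G := G) hr
  have c2 := sub_card_ge (G := G) hr
  rw [Fintype.card_fin] at c1 c2
  obtain ⟨H, k1, k2, k3⟩ := pad (sub_connected (r := r) hc) (by omega) (N := N) (by omega)
  refine ⟨H, ⟨k1, ?_, ?_⟩, ?_⟩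
  · rw [girth_eq_sInf, k2, cycLens_sub hr, sInf_scale, ← girth_eq_sInf, hg]
  · rw [circumference_eq, k2, cycLens_sub hr, sSup_scale _ (cycLens_bdd G), ← circumference_eq, hcc]
  · rw [k3, sub_hyp hc hr]

theorem class_finite (g c n : ℕ) :
    {d : ℝ | ∃ G : SimpleGraph (Fin n), memGclass g c G ∧ d = hypDelta G}.Finite := by
  refine (Set.finite_range (fun G : SimpleGraph (Fin n) => hypDelta G)).subset ?_
  rintro d ⟨G, -, rfl⟩
  exact ⟨G, rfl⟩

end final


/-- Theorem (extraT): if `G₁, G₂ ∈ 𝒢(g,c,n)` have `m₁, m₂` edges with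
`δ(G₁) = A(g,c,n)` and `δ(G₂) = B(g,c,n)`, then
`A(rg,rc,n₁) ≤ r·A(g,c,n) ≤ r·B(g,c,n) ≤ B(rg,rc,n₂)` for all
`n₁ ≥ n + (r-1)m₁` and `n₂ ≥ n + (r-1)m₂`. -/
theorem Agcn_Bgcn_scaling (g c n r m1 m2 n1 n2 : ℕ) (h3 : 3 ≤ g) (hgc : g ≤ c)
    (hcn : c ≤ n) (hr : 1 ≤ r)
    (G1 G2 : SimpleGraph (Fin n)) (hG1 : memGclass g c G1) (hG2 : memGclass g c G2)
    (hm1 : G1.edgeSet.ncard = m1) (hm2 : G2.edgeSet.ncard = m2)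
    (hd1 : hypDelta G1 = Agcn g c n) (hd2 : hypDelta G2 = Bgcn g c n)
    (hn1 : n + (r - 1) * m1 ≤ n1) (hn2 : n + (r - 1) * m2 ≤ n2) :
    Agcn (r * g) (r * c) n1 ≤ (r : ℝ) * Agcn g c n ∧
    (r : ℝ) * Agcn g c n ≤ (r : ℝ) * Bgcn g c n ∧
    (r : ℝ) * Bgcn g c n ≤ Bgcn (r * g) (r * c) n2 := by
  obtain ⟨H1, a1, b1⟩ := exists_scaled h3 hgc hcn hr G1 hG1 (N := n1) (by rw [hm1]; exact hn1)
  obtain ⟨H2, a2, b2⟩ := exists_scaled h3 hgc hcn hr G2 hG2 (N := n2) (by rw [hm2]; exact hn2)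
  refine ⟨?_, ?_, ?_⟩
  · rw [← hd1]
    exact csInf_le (class_finite _ _ _).bddBelow ⟨H1, a1, b1.symm⟩
  · refine mul_le_mul_of_nonneg_left ?_ (Nat.cast_nonneg r)
    rw [← hd1]
    exact le_csSup (class_finite g c n).bddAbove ⟨G1, hG1, rfl⟩
  · rw [← hd2]
    exact le_csSup (class_finite _ _ _).bddAbove ⟨H2, a2, b2.symm⟩
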